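/- arXiv:math/0701786 — 2 statements merged into one kernel-verified Lean document; each statement's English description precedes it below -/
import Mathlib

section
/- Let γ ∈ ℝ with γ ≠ 0 and |γ| ≠ 1, let b₁, c ∈ (1/4, 1/2) satisfy 2b₁ + c ≥ 1, and let s ≥ 0. Then there exists a constant C > 0 such that for all nonnegative measurable functions F, G : ℝ² → [0,∞): ‖ |ξ| ⟨ξ⟩^{s−1/2} ⟨τ+γ|ξ|ξ⟩^{−c} (F∗G)(τ,ξ) ‖_{L²_{τ,ξ}} ≤ C ( ‖⟨ξ⟩^{s}⟨τ+ξ²⟩^{b₁} F‖_{L²_{τ,ξ}} · ‖⟨τ−ξ²⟩^{b₁} G‖_{L²_{τ,ξ}} + ‖⟨τ+ξ²⟩^{b₁} F‖_{L²_{τ,ξ}} · ‖⟨ξ⟩^{s}⟨τ−ξ²⟩^{b₁} G‖_{L²_{τ,ξ}} ), where (F∗G)(τ,ξ) = ∫_{ℝ²} F(τ₁,ξ₁) G(τ−τ₁, ξ−ξ₁) dτ₁ dξ₁. (This is the Fourier-side formulation of the bilinear estimate ‖∂ₓ(u v̄)‖_{Y_γ^{s−1/2,−c}} ≲ ‖u‖_{X^{s,b₁}}‖v‖_{X^{0,b₁}}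 + ‖u‖_{X^{0,b₁}}‖v‖_{X^{s,b₁}}, with F = û and G the space-time Fourier transform of v̄.) -/
open MeasureTheory ENNReal

/-- Japanese bracket `⟨x⟩ = 1 + |x|`. -/
noncomputable def jb (x : ℝ) : ℝ := 1 + |x|

/-- Convolution of two nonnegative functions on `ℝ²`, valued in `ℝ≥0∞`. -/
noncomputable def convR2 (F G : ℝ × ℝ → ℝ) (p : ℝ × ℝ) : ℝ≥0∞ :=
  ∫⁻ q : ℝ × ℝ, ENNReal.ofReal (F q * G (p - q))

/-- The `L²` norm (valued in `ℝ≥0∞`) of a nonnegative function on `ℝ²`. -/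
noncomputable def l2R2 (f : ℝ × ℝ → ℝ) : ℝ≥0∞ :=
  (∫⁻ p : ℝ × ℝ, ENNReal.ofReal (f p) ^ 2) ^ (1/2 : ℝ)

lemma jb_ge (x : ℝ) : 1 ≤ jb x := by unfold jb; linarith [abs_nonneg x]
lemma jb_pos (x : ℝ) : 0 < jb x := lt_of_lt_of_le one_pos (jb_ge x)
lemma jb_add (x y : ℝ) : jb (x + y) ≤ jb x + jb y := by
  unfold jb; linarith [abs_add_le x y]

/-- power of the bracket, as an extended nonnegative real -/
noncomputable def W (e x : ℝ) : ℝ≥0∞ := ENNReal.ofReal (jb x ^ e)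

lemma W_mul (e e' x : ℝ) : W e x * W e' x = W (e + e') x := by
  unfold W
  rw [← ENNReal.ofReal_mul (Real.rpow_nonneg (jb_pos x).le _), Real.rpow_add (jb_pos x)]

lemma W_zero (x : ℝ) : W 0 x = 1 := by simp [W]

lemma W_ne_top (e x : ℝ) : W e x ≠ ⊤ := ENNReal.ofReal_ne_top

lemma W_mono {e e' : ℝ} (h : e ≤ e') (x : ℝ) : W e x ≤ W e' x :=
  ENNReal.ofReal_le_ofReal (Real.rpow_le_rpow_of_exponent_le (jb_ge x) h)

@[fun_prop]
lemma jb_meas : Measurable jb := by unfold jb; fun_prop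

@[fun_prop]
lemma W_meas (e : ℝ) : Measurable (W e) := by unfold W; fun_prop

/-- truncated power of the bracket -/
noncomputable def psi (p R x : ℝ) : ℝ≥0∞ := if |x| ≤ R then W (-p) x else 0

@[fun_prop]
lemma psi_meas (p R : ℝ) : Measurable (psi p R) := by
  unfold psi
  exact Measurable.ite (measurableSet_le (by fun_prop) (by fun_prop)) (by fun_prop) (by fun_prop)

lemma psi_neg (p R x : ℝ) : psi p R (-x) = psi p R x := by simp [psi, W, jb]

lemma trunc_half (p R : ℝ) (hp : p < 1) (hR : 0 ≤ R) :
    ∫⁻ x in Set.Ioc 0 R, W (-p) x ≤ ENNReal.ofReal (1/(1-p)) * W (1-p) R := by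
  have h1 : ∫⁻ x in Set.Ioc 0 R, W (-p) x = ENNReal.ofReal (∫ x in Set.Ioc 0 R, jb x ^ (-p)) := by
    rw [ofReal_integral_eq_lintegral_ofReal]
    · rfl
    · apply IntegrableOn.mono_set (t := Set.Icc 0 R) _ Set.Ioc_subset_Icc_self
      apply ContinuousOn.integrableOn_Icc
      apply ContinuousOn.rpow_const
      · unfold jb; fun_prop
      · intro x _; left; exact (jb_pos x).ne'
    · exact Filter.Eventually.of_forall fun x => Real.rpow_nonneg (jb_pos x).le _
  rw [h1, W, ← ENNReal.ofReal_mul (by rw [one_div, inv_nonneg]; linarith)]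
  apply ENNReal.ofReal_le_ofReal
  rw [← intervalIntegral.integral_of_le hR]
  have h2 : ∫ x in (0:ℝ)..R, jb x ^ (-p) = ∫ x in (0:ℝ)..R, (1 + x) ^ (-p) := by
    apply intervalIntegral.integral_congr
    intro x hx
    rw [Set.uIcc_of_le hR] at hx
    simp only [jb, abs_of_nonneg hx.1]
  rw [h2, intervalIntegral.integral_comp_add_left (fun x => x ^ (-p)) 1,
    integral_rpow (Or.inl (by linarith))]
  simp only [jb, abs_of_nonneg hR]
  have : -p + 1 = 1 - p := by ring
  rw [this, div_mul_eq_mul_div, one_mul]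
  apply div_le_div_of_nonneg_right _ (by linarith)
  have : 0 ≤ (1 + 0 : ℝ) ^ (1-p) := by positivity
  linarith

lemma trunc (p R : ℝ) (hp : p < 1) (hR : 0 ≤ R) :
    ∫⁻ x, psi p R x ≤ ENNReal.ofReal (2/(1-p)) * W (1-p) R := by
  have h0 : ∀ x, psi p R x ≤ (Set.Ioc 0 R).indicator (W (-p)) x
      + (Set.Ioc 0 R).indicator (W (-p)) (-x) + ({0} : Set ℝ).indicator (W (-p)) x := by
    intro x
    unfold psi
    split_ifs with h
    · rcases lt_trichotomy x 0 with h1 | h1 | h1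
      · rw [abs_of_neg h1] at h
        rw [Set.indicator_of_mem (a := -x) (by constructor <;> linarith)]
        have : W (-p) (-x) = W (-p) x := by simp [W, jb]
        rw [this]
        exact le_add_right le_add_self
      · rw [Set.indicator_of_mem (a := x) (s := {0}) (by simp [h1])]
        exact le_add_self
      · rw [abs_of_pos h1] at h
        rw [Set.indicator_of_mem (a := x) (s := Set.Ioc 0 R) (by constructor <;> linarith)]
        rw [add_assoc]
        exact le_add_right le_rfl
    · exact zero_le
  have hm : Measurable ((Set.Ioc 0 R).indicator (W (-p))) :=
    (W_meas _).indicator measurableSet_Ioc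
  calc ∫⁻ x, psi p R x ≤ _ := lintegral_mono h0
    _ = 2 * ∫⁻ x in Set.Ioc 0 R, W (-p) x := by
        rw [lintegral_add_left (by fun_prop), lintegral_add_left (by fun_prop),
          lintegral_neg_eq_self (fun x => (Set.Ioc 0 R).indicator (W (-p)) x),
          lintegral_indicator measurableSet_Ioc, lintegral_indicator (measurableSet_singleton _)]
        simp [two_mul]
    _ ≤ 2 * (ENNReal.ofReal (1/(1-p)) * W (1-p) R) := by gcongr; exact trunc_half p R hp hR
    _ = _ := by
        rw [← mul_assoc]; congr 1
        rw [← ENNReal.ofReal_ofNat 2, ← ENNReal.ofReal_mul (by norm_num)]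
        congr 1; ring

lemma quad_half (η a K : ℝ) (ψ : ℝ → ℝ≥0∞) (s : Set ℝ) (hs : MeasurableSet s)
    (hi : ∀ x ∈ s, ∀ y ∈ s, 2*η - a*(x+y) ≠ 0) :
    ∫⁻ x in s, ENNReal.ofReal |2*η - 2*a*x| * ψ (K + 2*η*x - a*x^2) ≤ ∫⁻ x, ψ x := by
  have hd : ∀ x ∈ s, HasDerivWithinAt (fun x => K + 2*η*x - a*x^2) (2*η - 2*a*x) s x := by
    intro x _
    apply HasDerivAt.hasDerivWithinAt
    have h1 := (((hasDerivAt_id x).const_mul (2*η)).const_add K).sub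
      (((hasDerivAt_id x).pow 2).const_mul a)
    have h2 : (2*η - 2*a*x) = (2 * η * 1 - a * ((2:ℕ) * id x ^ (2 - 1) * 1)) := by
      simp; ring
    rw [h2]
    exact h1
  have hinj : Set.InjOn (fun x => K + 2*η*x - a*x^2) s := by
    intro x hx y hy hxy
    have : (x - y) * (2*η - a*(x+y)) = 0 := by
      simp only at hxy; linarith
    rcases mul_eq_zero.1 this with h | h
    · linarith
    · exact absurd h (hi x hx y hy)
  rw [← lintegral_image_eq_lintegral_abs_deriv_mul hs hd hinj ψ]
  exact setLIntegral_le_lintegral _ _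

lemma sub_quad (η a K : ℝ) (ψ : ℝ → ℝ≥0∞) (hψ : Measurable ψ) :
    ∫⁻ x, ENNReal.ofReal |2*η - 2*a*x| * ψ (K + 2*η*x - a*x^2) ≤ 2 * ∫⁻ x, ψ x := by
  set f := fun x => ENNReal.ofReal |2*η - 2*a*x| * ψ (K + 2*η*x - a*x^2) with hf
  have hs1 : MeasurableSet {x : ℝ | 0 < 2*η - 2*a*x} := measurableSet_lt (by fun_prop) (by fun_prop)
  have hs2 : MeasurableSet {x : ℝ | 2*η - 2*a*x < 0} := measurableSet_lt (by fun_prop) (by fun_prop)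
  have h0 : ∀ x, f x ≤ {x : ℝ | 0 < 2*η - 2*a*x}.indicator f x
      + {x : ℝ | 2*η - 2*a*x < 0}.indicator f x := by
    intro x
    rcases lt_trichotomy (2*η - 2*a*x) 0 with h1 | h1 | h1
    · rw [Set.indicator_of_mem (s := {x : ℝ | 2*η - 2*a*x < 0}) h1]
      exact le_add_self
    · simp [hf, h1]
    · rw [Set.indicator_of_mem (s := {x : ℝ | 0 < 2*η - 2*a*x}) h1]
      exact le_add_right le_rfl
  calc ∫⁻ x, f x ≤ _ := lintegral_mono h0
    _ ≤ _ := by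
      have hfm : Measurable f := by fun_prop
      rw [lintegral_add_left (hfm.indicator hs1), lintegral_indicator hs1, lintegral_indicator hs2,
        two_mul (∫⁻ x, ψ x)]
      apply add_le_add
      · apply quad_half _ _ _ _ _ hs1
        intro x hx y hy
        simp only [Set.mem_ofPred_eq] at hx hy
        intro h; nlinarith
      · apply quad_half _ _ _ _ _ hs2
        intro x hx y hy
        simp only [Set.mem_ofPred_eq] at hx hy
        intro h; nlinarith
lemma split_real (θ m y : ℝ) (h0 : 0 ≤ θ) (h1 : θ ≤ 1/2) :
    jb m ^ (-θ) ≤ 2*|y| * jb m ^ (-(θ+1/2)) + 2 * jb y ^ (-(2*θ)) := by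
  have hm := jb_pos m
  have hy := jb_pos y
  have e1 : 0 ≤ 2*|y| * jb m ^ (-(θ+1/2)) := by positivity
  have e2 : 0 ≤ jb y ^ (-(2*θ)) := by positivity
  by_cases hc : jb y ^ 2 ≤ jb m
  · have : jb m ^ (-θ) ≤ jb y ^ (-(2*θ)) := by
      calc jb m ^ (-θ) ≤ (jb y ^ 2) ^ (-θ) :=
            Real.rpow_le_rpow_of_nonpos (by positivity) hc (by linarith)
        _ = _ := by
            rw [← Real.rpow_natCast, ← Real.rpow_mul hy.le]
            congr 1; push_cast; ring
    linarith
  · push Not at hc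
    by_cases hy1 : 1 ≤ |y|
    · have : jb m ^ (-θ) ≤ 2*|y| * jb m ^ (-(θ+1/2)) := by
        have e3 : jb m ^ (-θ) = jb m ^ (1/2 : ℝ) * jb m ^ (-(θ+1/2)) := by
          rw [← Real.rpow_add hm]; congr 1; ring
        rw [e3]
        apply mul_le_mul_of_nonneg_right _ (by positivity)
        rw [← Real.sqrt_eq_rpow]
        calc √(jb m) ≤ √(jb y ^ 2) := Real.sqrt_le_sqrt hc.le
          _ = jb y := Real.sqrt_sq hy.le
          _ ≤ _ := by unfold jb; linarith
      linarith
    · push Not at hy1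
      have e4 : jb m ^ (-θ) ≤ 1 := Real.rpow_le_one_of_one_le_of_nonpos (jb_ge m) (by linarith)
      have e5 : (1/2 : ℝ) ≤ jb y ^ (-(2*θ)) := by
        calc (1/2 : ℝ) = 2 ^ (-1 : ℝ) := by rw [Real.rpow_neg_one]; norm_num
          _ ≤ 2 ^ (-(2*θ)) := Real.rpow_le_rpow_of_exponent_le (by norm_num) (by linarith)
          _ ≤ _ := Real.rpow_le_rpow_of_nonpos hy (by unfold jb; linarith) (by linarith)
      linarith

/-- pointwise bound behind the one dimensional estimate -/
lemma one_dim_pt (θ a η ω ξ : ℝ) (h0 : 0 ≤ θ) (h1 : θ ≤ 1/2) (ha : a ≠ 0) :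
    ENNReal.ofReal |ξ| * psi θ (2*|ω|) (ω - 2*η*ξ + a*ξ^2) ≤
      ENNReal.ofReal (2/|a|) * (ENNReal.ofReal |2*η - 2*a*ξ| * psi θ (2*|ω|) (ω - 2*η*ξ + a*ξ^2))
      + ENNReal.ofReal (√(6/|a|)/|a|) * W (1/2) ω *
        (ENNReal.ofReal |2*η - 2*a*ξ| * psi (θ+1/2) (2*|ω|) (ω - 2*η*ξ + a*ξ^2))
      + ENNReal.ofReal (2*√(6/|a|)) * W (1/2) ω *
        psi (2*θ) (√(6/|a|) * jb ω ^ (1/2 : ℝ)) (ξ - η/a) := by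
  set m := ω - 2*η*ξ + a*ξ^2 with hm
  have ha' : 0 < |a| := abs_pos.2 ha
  by_cases hmR : |m| ≤ 2*|ω|
  swap
  · simp [psi, hmR]
  simp only [psi, if_pos hmR]
  by_cases hbig : |a| * |ξ|/2 ≤ |2*η - 2*a*ξ|
  · rw [add_assoc]
    apply le_add_right
    rw [← mul_assoc, ← ENNReal.ofReal_mul (by positivity)]
    gcongr
    rw [div_mul_eq_mul_div, le_div_iff₀ ha']
    linarith
  · push Not at hbig
    have hξ : |ξ| ≤ √(6/|a|) * jb ω ^ (1/2 : ℝ) := by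
      have k1 : |2*η*ξ - a*ξ^2| ≤ 3*|ω| := by
        have : 2*η*ξ - a*ξ^2 = ω - m := by rw [hm]; ring
        rw [this]
        linarith [abs_sub ω m]
      have k2 : |a| * ξ^2/2 ≤ |2*η*ξ - a*ξ^2| := by
        have : 2*η*ξ - a*ξ^2 = ξ * (a*ξ + (2*η - 2*a*ξ)) := by ring
        rw [this, abs_mul]
        have k3 : |a*ξ| - |2*η - 2*a*ξ| ≤ |a*ξ + (2*η - 2*a*ξ)| := by
          have := abs_sub_abs_le_abs_sub (a*ξ) (-(2*η - 2*a*ξ))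
          rwa [abs_neg, sub_neg_eq_add] at this
        rw [abs_mul] at k3
        have := abs_nonneg ξ
        have e : ξ^2 = |ξ| * |ξ| := by rw [← sq, sq_abs]
        rw [e]
        nlinarith
      rw [← Real.sqrt_eq_rpow, ← Real.sqrt_mul (by positivity)]
      apply Real.abs_le_sqrt
      rw [div_mul_eq_mul_div, le_div_iff₀ ha']
      unfold jb
      linarith
    have hya : |ξ - η/a| * (2*|a|) = |2*η - 2*a*ξ| := by
      have : 2*η - 2*a*ξ = -((ξ - η/a) * (2*a)) := by field_simp; ring
      rw [this, abs_neg, abs_mul, abs_mul]; simp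
    have hy : |ξ - η/a| ≤ √(6/|a|) * jb ω ^ (1/2 : ℝ) := by
      have : |ξ - η/a| ≤ |ξ| := by
        have := abs_nonneg ξ
        by_contra hcon
        push Not at hcon
        nlinarith
      linarith
    rw [if_pos hy, add_assoc]
    apply le_add_left
    have hw := jb_pos ω
    have hmp := jb_pos m
    have hyp := jb_pos (ξ - η/a)
    have hs := split_real θ m (ξ - η/a) h0 h1
    unfold W
    simp only [← ENNReal.ofReal_mul (abs_nonneg _)]
    have q1 : 0 ≤ √(6/|a|)/|a| * jb ω ^ (1/2 : ℝ) := by positivity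
    have q2 : 0 ≤ 2*√(6/|a|) * jb ω ^ (1/2 : ℝ) := by positivity
    rw [← ENNReal.ofReal_mul (by positivity), ← ENNReal.ofReal_mul q1,
      ← ENNReal.ofReal_mul (by positivity), ← ENNReal.ofReal_mul q2,
      ← ENNReal.ofReal_add (by positivity) (by positivity)]
    apply ENNReal.ofReal_le_ofReal
    calc |ξ| * jb m ^ (-θ) ≤ (√(6/|a|) * jb ω ^ (1/2 : ℝ)) *
          (2*|ξ - η/a| * jb m ^ (-(θ+1/2)) + 2 * jb (ξ - η/a) ^ (-(2*θ))) := by gcongr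
      _ = _ := by rw [← hya]; field_simp

lemma W_two (e x : ℝ) (he : 0 ≤ e) : W e (2*|x|) ≤ ENNReal.ofReal (2 ^ e) * W e x := by
  unfold W
  rw [← ENNReal.ofReal_mul (by positivity), ← Real.mul_rpow (by norm_num) (jb_pos x).le]
  apply ENNReal.ofReal_le_ofReal
  apply Real.rpow_le_rpow (jb_pos _).le _ he
  unfold jb
  rw [abs_mul, abs_abs, abs_two]
  linarith [abs_nonneg x]

lemma W_half (e κ x : ℝ) (he : 0 ≤ e) (hκ : 0 ≤ κ) :
    W e (κ * jb x ^ (1/2 : ℝ)) ≤ ENNReal.ofReal ((1+κ) ^ e) * W (e/2) x := by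
  unfold W
  have hx := jb_pos x
  have : jb x ^ (e/2) = (jb x ^ (1/2 : ℝ)) ^ e := by
    rw [← Real.rpow_mul hx.le]; congr 1; ring
  rw [← ENNReal.ofReal_mul (by positivity), this, ← Real.mul_rpow (by positivity) (by positivity)]
  apply ENNReal.ofReal_le_ofReal
  apply Real.rpow_le_rpow (jb_pos _).le _ he
  have h1 : 1 ≤ jb x ^ (1/2 : ℝ) := Real.one_le_rpow (jb_ge x) (by norm_num)
  nth_rewrite 1 [jb]
  rw [abs_of_nonneg (by positivity)]
  linarith

lemma one_dim (θ a : ℝ) (h0 : 0 ≤ θ) (h1 : θ < 1/2) (ha : a ≠ 0) :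
    ∃ C : ℝ≥0∞, C ≠ ⊤ ∧ ∀ η ω : ℝ,
      ∫⁻ ξ, ENNReal.ofReal |ξ| * psi θ (2*|ω|) (ω - 2*η*ξ + a*ξ^2) ≤ C * W (1-θ) ω := by
  have hsub : ∀ p η ω : ℝ, p < 1 → ∫⁻ ξ, (ENNReal.ofReal |2*η - 2*a*ξ| *
      psi p (2*|ω|) (ω - 2*η*ξ + a*ξ^2)) ≤
      2 * (ENNReal.ofReal (2/(1-p)) * (ENNReal.ofReal (2^(1-p)) * W (1-p) ω)) := by
    intro p η ω hp
    have := sub_quad η a (-ω) (psi p (2*|ω|)) (by fun_prop)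
    calc _ = _ := by
          apply lintegral_congr
          intro ξ
          rw [← psi_neg p _ (ω - 2*η*ξ + a*ξ^2)]
      _ ≤ _ := by
          refine le_trans (le_of_eq ?_) (this.trans ?_)
          · apply lintegral_congr
            intro ξ
            congr 2; ring
          · gcongr
            refine (trunc p _ hp (by positivity)).trans ?_
            gcongr
            exact W_two _ _ (by linarith)
  set κ := √(6/|a|) with hκ
  have hκ0 : 0 ≤ κ := Real.sqrt_nonneg _
  refine ⟨ENNReal.ofReal (2/|a|) * (2 * (ENNReal.ofReal (2/(1-θ)) * ENNReal.ofReal (2^(1-θ))))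
    + ENNReal.ofReal (κ/|a|) * (2 * (ENNReal.ofReal (2/(1-(θ+1/2))) *
      ENNReal.ofReal (2^(1-(θ+1/2)))))
    + ENNReal.ofReal (2*κ) * (ENNReal.ofReal (2/(1-2*θ)) * ENNReal.ofReal ((1+κ)^(1-2*θ))),
    by finiteness, ?_⟩
  intro η ω
  calc _ ≤ _ := lintegral_mono fun ξ => one_dim_pt θ a η ω ξ h0 h1.le ha
    _ ≤ ENNReal.ofReal (2/|a|) *
        (2 * (ENNReal.ofReal (2/(1-θ)) * (ENNReal.ofReal (2^(1-θ)) * W (1-θ) ω)))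
        + ENNReal.ofReal (κ/|a|) * W (1/2) ω * (2 * (ENNReal.ofReal (2/(1-(θ+1/2))) *
          (ENNReal.ofReal (2^(1-(θ+1/2))) * W (1-(θ+1/2)) ω)))
        + ENNReal.ofReal (2*κ) * W (1/2) ω * (ENNReal.ofReal (2/(1-2*θ)) *
          (ENNReal.ofReal ((1+κ)^(1-2*θ)) * W ((1-2*θ)/2) ω)) := by
      rw [lintegral_add_left (by fun_prop), lintegral_add_left (by fun_prop),
        lintegral_const_mul _ (by fun_prop), lintegral_const_mul _ (by fun_prop),
        lintegral_const_mul _ (by fun_prop)]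
      gcongr
      · exact hsub θ η ω (by linarith)
      · exact hsub (θ+1/2) η ω (by linarith)
      · rw [lintegral_sub_right_eq_self (fun x => psi (2*θ) (√(6/|a|) * jb ω ^ (1/2 : ℝ)) x)]
        have := jb_pos ω
        refine (trunc _ _ (by linarith) (by positivity)).trans ?_
        gcongr
        exact W_half _ _ _ (by linarith) hκ0
    _ = _ := by
      have e1 : W (1-θ) ω = W (1/2) ω * W (1-(θ+1/2)) ω := by rw [W_mul]; congr 1; ring
      have e2 : W ((1-2*θ)/2) ω = W (1-(θ+1/2)) ω := by congr 1; ring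
      rw [e2, e1]
      ring
lemma W_pt (p q θ x m : ℝ) (h0 : 0 ≤ θ) (hq : θ ≤ q) (h : jb x ≤ jb (x - m)) :
    W (-p) x * W (-q) (x-m) ≤ ENNReal.ofReal (2^θ) * W (-θ) m * W (-(p+q-θ)) x := by
  have hx := jb_pos x
  have hm := jb_pos m
  have hy := jb_pos (x-m)
  have h1 : jb m ≤ 2 * jb (x-m) := by
    have : jb m ≤ jb x + jb (x-m) := by
      unfold jb
      have := abs_sub x (x-m)
      rw [show x - (x-m) = m by ring] at this
      linarith
    linarith
  unfold W
  rw [← ENNReal.ofReal_mul (by positivity), ← ENNReal.ofReal_mul (by positivity),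
    ← ENNReal.ofReal_mul (by positivity)]
  apply ENNReal.ofReal_le_ofReal
  have e1 : jb (x-m) ^ (-q) = jb (x-m) ^ (-θ) * jb (x-m) ^ (-(q-θ)) := by
    rw [← Real.rpow_add hy]; congr 1; ring
  have e2 : jb x ^ (-(p+q-θ)) = jb x ^ (-p) * jb x ^ (-(q-θ)) := by
    rw [← Real.rpow_add hx]; congr 1; ring
  have e3 : jb (x-m) ^ (-θ) ≤ 2^θ * jb m ^ (-θ) := by
    calc jb (x-m) ^ (-θ) ≤ (jb m / 2) ^ (-θ) :=
          Real.rpow_le_rpow_of_nonpos (by positivity) (by linarith) (by linarith)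
      _ = _ := by
          rw [Real.div_rpow hm.le (by norm_num), Real.rpow_neg (by norm_num : (0:ℝ) ≤ 2)]
          field_simp
  have e4 : jb (x-m) ^ (-(q-θ)) ≤ jb x ^ (-(q-θ)) :=
    Real.rpow_le_rpow_of_nonpos hx h (by linarith)
  rw [e1, e2]
  calc jb x ^ (-p) * (jb (x-m) ^ (-θ) * jb (x-m) ^ (-(q-θ)))
      ≤ jb x ^ (-p) * ((2^θ * jb m ^ (-θ)) * jb x ^ (-(q-θ))) := by gcongr
    _ = _ := by ring

lemma psi_pt (p q θ R x m : ℝ) (h0 : 0 ≤ θ) (hp : θ ≤ p) (hq : θ ≤ q) :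
    psi p R x * psi q R (x-m) ≤ ENNReal.ofReal (2^θ) * psi θ (2*R) m *
      (psi (p+q-θ) R x + psi (p+q-θ) R (x-m)) := by
  unfold psi
  by_cases h1 : |x| ≤ R
  swap
  · simp [h1]
  by_cases h2 : |x-m| ≤ R
  swap
  · simp [h2]
  have h3 : |m| ≤ 2*R := by
    have := abs_sub x (x-m)
    rw [show x - (x-m) = m by ring] at this
    linarith
  rw [if_pos h1, if_pos h1, if_pos h2, if_pos h2, if_pos h3]
  rcases le_total (jb x) (jb (x-m)) with h | h
  · refine (W_pt p q θ x m h0 hq h).trans ?_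
    gcongr
    exact le_self_add
  · have h' : jb (x-m) ≤ jb ((x-m) - (-m)) := by simpa using h
    have := W_pt q p θ (x-m) (-m) h0 hp h'
    have e : W (-θ) (-m) = W (-θ) m := by simp [W, jb]
    rw [e, sub_neg_eq_add, sub_add_cancel, add_comm q p] at this
    rw [mul_comm]
    refine this.trans ?_
    gcongr
    exact le_add_self

lemma caseB (a b : ℝ) (ha : a ≠ 0) (hb : 1/4 < b) (hb' : b < 1/2) :
    ∃ C : ℝ≥0∞, C ≠ ⊤ ∧ ∀ η ω : ℝ,
      ∫⁻ ξ, ∫⁻ x, ENNReal.ofReal |ξ| * (psi (2*(1-2*b)) |ω| x *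
        psi (2*b) |ω| (x - (ω - 2*η*ξ + a*ξ^2))) ≤ C * W (2*b) ω := by
  obtain ⟨θ, hθ1, hθ2⟩ := exists_between (show 1-2*b < min (1/2) (2*(1-2*b)) by
    rw [lt_min_iff]; constructor <;> linarith)
  rw [lt_min_iff] at hθ2
  obtain ⟨C, hC, h⟩ := one_dim θ a (by linarith) hθ2.1 ha
  set r := 2*(1-2*b) + 2*b - θ with hr
  refine ⟨ENNReal.ofReal (2^θ) * (2 * (ENNReal.ofReal (2/(1-r)))) * C, by finiteness, ?_⟩
  intro η ω
  calc _ ≤ ∫⁻ ξ, (ENNReal.ofReal (2^θ) * (2 * (ENNReal.ofReal (2/(1-r)) * W (1-r) |ω|))) *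
          (ENNReal.ofReal |ξ| * psi θ (2*|ω|) (ω - 2*η*ξ + a*ξ^2)) := by
        apply lintegral_mono
        intro ξ
        simp only
        set m := ω - 2*η*ξ + a*ξ^2
        rw [lintegral_const_mul _ (by fun_prop)]
        calc _ ≤ ENNReal.ofReal |ξ| * ∫⁻ x, ENNReal.ofReal (2^θ) * psi θ (2*|ω|) m *
              (psi r |ω| x + psi r |ω| (x-m)) := by
              gcongr ENNReal.ofReal |ξ| * ?_
              apply lintegral_mono
              intro x
              exact psi_pt _ _ _ _ _ _ (by linarith) hθ2.2.le (by linarith)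
          _ = ENNReal.ofReal |ξ| * (ENNReal.ofReal (2^θ) * psi θ (2*|ω|) m *
              (2 * ∫⁻ x, psi r |ω| x)) := by
              rw [lintegral_const_mul _ (by fun_prop), lintegral_add_left (by fun_prop),
                lintegral_sub_right_eq_self (fun x => psi r |ω| x), two_mul (∫⁻ x, psi r |ω| x)]
          _ ≤ ENNReal.ofReal |ξ| * (ENNReal.ofReal (2^θ) * psi θ (2*|ω|) m *
              (2 * (ENNReal.ofReal (2/(1-r)) * W (1-r) |ω|))) := by
              gcongr
              exact trunc _ _ (by linarith) (abs_nonneg _)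
          _ = _ := by ring
    _ = (ENNReal.ofReal (2^θ) * (2 * (ENNReal.ofReal (2/(1-r)) * W (1-r) |ω|))) *
          ∫⁻ ξ, (ENNReal.ofReal |ξ| * psi θ (2*|ω|) (ω - 2*η*ξ + a*ξ^2)) :=
        lintegral_const_mul _ (by fun_prop)
    _ ≤ (ENNReal.ofReal (2^θ) * (2 * (ENNReal.ofReal (2/(1-r)) * W (1-r) |ω|))) *
          (C * W (1-θ) ω) := by gcongr; exact h η ω
    _ = _ := by
        have e1 : W (1-r) |ω| = W (1-r) ω := by simp [W, jb]
        have e2 : W (2*b) ω = W (1-r) ω * W (1-θ) ω := by rw [W_mul]; congr 1; rw [hr]; ring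
        rw [e1, e2]; ring

lemma caseA (b : ℝ) (hb' : b < 1/2) :
    ∃ C : ℝ≥0∞, C ≠ ⊤ ∧ ∀ ξ w R : ℝ, 0 ≤ R →
      ∫⁻ z, ∫⁻ x, ENNReal.ofReal |ξ| * (psi (2*b) R x *
        psi (2*b) R (w + 2*ξ*z - x)) ≤ C * W (2*(1-2*b)) R := by
  refine ⟨2 * ENNReal.ofReal (2/(1-2*b)) * ENNReal.ofReal (2/(1-2*b)), by finiteness, ?_⟩
  intro ξ w R hR
  have ht := trunc (2*b) R (by linarith) hR
  rw [lintegral_lintegral_swap (by fun_prop)]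
  calc _ ≤ ∫⁻ x, psi (2*b) R x * (2 * (ENNReal.ofReal (2/(1-2*b)) * W (1-2*b) R)) := by
        apply lintegral_mono
        intro x
        simp only
        calc _ = psi (2*b) R x *
              ∫⁻ z, ENNReal.ofReal |ξ| * psi (2*b) R (w + 2*ξ*z - x) := by
              rw [← lintegral_const_mul _ (by fun_prop)]
              apply lintegral_congr
              intro z; ring
          _ ≤ psi (2*b) R x *
              ∫⁻ z, ENNReal.ofReal |2*ξ-2*0*z| * psi (2*b) R ((w-x) + 2*ξ*z - 0*z^2) := by
              gcongr psi (2*b) R x * ?_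
              apply lintegral_mono
              intro z
              simp only
              apply mul_le_mul'
              · apply ENNReal.ofReal_le_ofReal
                rw [mul_zero, zero_mul, sub_zero, abs_mul, abs_two]
                linarith [abs_nonneg ξ]
              · apply le_of_eq; congr 1; ring
          _ ≤ _ := by
              gcongr
              refine (sub_quad ξ 0 (w-x) (psi (2*b) R) (by fun_prop)).trans ?_
              gcongr
    _ = (∫⁻ x, psi (2*b) R x) * (2 * (ENNReal.ofReal (2/(1-2*b)) * W (1-2*b) R)) :=
        lintegral_mul_const _ (by fun_prop)
    _ ≤ (ENNReal.ofReal (2/(1-2*b)) * W (1-2*b) R) *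
        (2 * (ENNReal.ofReal (2/(1-2*b)) * W (1-2*b) R)) := by gcongr
    _ = _ := by
        have e2 : W (2*(1-2*b)) R = W (1-2*b) R * W (1-2*b) R := by rw [W_mul]; congr 1; ring
        rw [e2]; ring

/-- Cauchy–Schwarz -/
lemma cs {α : Type*} [MeasurableSpace α] (μ : Measure α) (f g : α → ℝ≥0∞)
    (hf : Measurable f) (hg : Measurable g) :
    ∫⁻ x, f x * g x ∂μ ≤ (∫⁻ x, f x ^ 2 ∂μ) ^ (1/2 : ℝ) * (∫⁻ x, g x ^ 2 ∂μ) ^ (1/2 : ℝ) := by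
  have := ENNReal.lintegral_mul_le_Lp_mul_Lq μ Real.HolderConjugate.two_two
    hf.aemeasurable hg.aemeasurable
  simpa using this

lemma trilin {α β : Type*} [MeasurableSpace α] [MeasurableSpace β] (μ : Measure α)
    (ν : Measure β) [SFinite μ] [SFinite ν] (f : α → ℝ≥0∞) (K U : α → β → ℝ≥0∞) (M : ℝ≥0∞)
    (hf : Measurable f) (hK : Measurable (Function.uncurry K)) (hU : Measurable (Function.uncurry U))
    (hM : ∀ x, ∫⁻ y, K x y ^ 2 ∂ν ≤ M) :
    ∫⁻ x, ∫⁻ y, f x * (K x y * U x y) ∂ν ∂μ ≤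
      M ^ (1/2 : ℝ) * ((∫⁻ x, f x ^ 2 ∂μ) ^ (1/2 : ℝ) *
        (∫⁻ x, ∫⁻ y, U x y ^ 2 ∂ν ∂μ) ^ (1/2 : ℝ)) := by
  have hKx : ∀ x, Measurable (K x) := fun x => hK.comp measurable_prodMk_left
  have hUx : ∀ x, Measurable (U x) := fun x => hU.comp measurable_prodMk_left
  have hN : Measurable fun x => ∫⁻ y, U x y ^ 2 ∂ν :=
    Measurable.lintegral_prod_right' (f := fun z => Function.uncurry U z ^ 2) (hU.pow_const 2)
  calc _ ≤ ∫⁻ x, M ^ (1/2 : ℝ) * (f x * (∫⁻ y, U x y ^ 2 ∂ν) ^ (1/2 : ℝ)) ∂μ := by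
        apply lintegral_mono
        intro x
        simp only
        rw [lintegral_const_mul (f := fun y => K x y * U x y) _ ((hKx x).mul (hUx x))]
        calc _ ≤ f x * (M ^ (1/2 : ℝ) * (∫⁻ y, U x y ^ 2 ∂ν) ^ (1/2 : ℝ)) := by
              gcongr
              refine (cs ν _ _ (hKx x) (hUx x)).trans ?_
              gcongr
              exact hM x
          _ = _ := by ring
    _ = M ^ (1/2 : ℝ) * ∫⁻ x, (f x * (∫⁻ y, U x y ^ 2 ∂ν) ^ (1/2 : ℝ)) ∂μ :=
        lintegral_const_mul _ (by fun_prop)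
    _ ≤ _ := by
        gcongr
        refine (cs μ _ _ hf (by fun_prop)).trans ?_
        gcongr with x
        rw [← ENNReal.rpow_natCast, ← ENNReal.rpow_mul]
        simp

lemma duality {α : Type*} [MeasurableSpace α] (μ : Measure α) [SigmaFinite μ] (T : α → ℝ≥0∞)
    (hT : Measurable T) (M : ℝ≥0∞)
    (h : ∀ H : α → ℝ≥0∞, Measurable H → ∫⁻ x, T x * H x ∂μ ≤ M * (∫⁻ x, H x ^ 2 ∂μ) ^ (1/2 : ℝ)) :
    (∫⁻ x, T x ^ 2 ∂μ) ^ (1/2 : ℝ) ≤ M := by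
  set S := spanningSets μ
  set Tn : ℕ → α → ℝ≥0∞ := fun n => (S n).indicator (fun x => min (T x) n) with hTn
  have hSm : ∀ n, MeasurableSet (S n) := measurableSet_spanningSets μ
  have hm : ∀ n, Measurable (Tn n) := fun n =>
    (hT.min measurable_const).indicator (hSm n)
  have hle : ∀ n x, Tn n x ≤ T x := by
    intro n x
    apply Set.indicator_apply_le'
    · intro _; exact min_le_left _ _
    · intro _; exact zero_le
  have hmono : Monotone Tn := by
    intro n k hnk x
    simp only [hTn]
    by_cases hx : x ∈ S n
    · have hx' : x ∈ S k := monotone_spanningSets μ hnk hx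
      rw [Set.indicator_of_mem hx, Set.indicator_of_mem hx']
      gcongr
    · rw [Set.indicator_of_notMem hx]; exact zero_le
  have hn : ∀ n, ∫⁻ x, Tn n x ^ 2 ∂μ ≤ M ^ 2 := by
    intro n
    set I := ∫⁻ x, Tn n x ^ 2 ∂μ with hI
    have hfin : I ≠ ⊤ := by
      apply ne_of_lt
      calc I ≤ ∫⁻ x, (S n).indicator (fun _ => (n : ℝ≥0∞)^2) x ∂μ := by
            apply lintegral_mono
            intro x
            by_cases hx : x ∈ S n
            · simp only [hTn, Set.indicator_of_mem hx]
              gcongr; exact min_le_right _ _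
            · simp [hTn, Set.indicator_of_notMem hx]
        _ < ⊤ := by
            rw [lintegral_indicator (hSm n), setLIntegral_const]
            have := measure_spanningSets_lt_top μ n
            exact ENNReal.mul_lt_top (by finiteness) this
    have h1 : I ≤ M * I ^ (1/2 : ℝ) := by
      refine le_trans ?_ (h (Tn n) (hm n))
      apply lintegral_mono
      intro x
      simp only [sq]
      gcongr
      exact hle n x
    by_cases hI0 : I = 0
    · rw [hI0]; exact zero_le
    have e : I = I ^ (1/2 : ℝ) * I ^ (1/2 : ℝ) := by
      rw [← ENNReal.rpow_add _ _ hI0 hfin]; norm_num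
    have hs0 : I ^ (1/2 : ℝ) ≠ 0 := by
      intro h0; rw [h0, zero_mul] at e; exact hI0 e
    have hst : I ^ (1/2 : ℝ) ≠ ⊤ := ENNReal.rpow_ne_top_of_nonneg (by norm_num) hfin
    have h2 : I ^ (1/2 : ℝ) ≤ M := by
      nth_rewrite 1 [e] at h1
      exact (ENNReal.mul_le_mul_iff_left hs0 hst).1 h1
    rw [e, sq]
    gcongr
  have hsup : ∀ x, T x ^ 2 = ⨆ n, Tn n x ^ 2 := by
    intro x
    apply le_antisymm
    · obtain ⟨N, hN⟩ : ∃ N, x ∈ S N := ⟨_, mem_spanningSetsIndex μ x⟩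
      have hNk : ∀ k, N ≤ k → Tn k x = min (T x) k := fun k hk =>
        Set.indicator_of_mem (monotone_spanningSets μ hk hN) _
      by_cases htop : T x = ⊤
      · rw [htop]
        apply le_of_eq
        symm
        rw [ENNReal.top_pow two_ne_zero]
        apply ENNReal.eq_top_of_forall_nnreal_le
        intro r
        obtain ⟨k, hk⟩ := exists_nat_ge r
        refine le_trans ?_ (le_iSup _ (max (max k N) 1))
        rw [hNk _ ((le_max_right k N).trans (le_max_left _ _)), htop, min_eq_right le_top]
        have h1 : r ≤ ((max (max k N) 1 : ℕ) : NNReal) ^ 2 := by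
          have a1 : (k : NNReal) ≤ ((max (max k N) 1 : ℕ) : NNReal) :=
            Nat.cast_le.2 ((le_max_left k N).trans (le_max_left _ _))
          have a2 : (1 : NNReal) ≤ ((max (max k N) 1 : ℕ) : NNReal) :=
            Nat.one_le_cast.2 (le_max_right _ _)
          calc r ≤ _ := hk.trans a1
            _ ≤ _ := le_self_pow₀ a2 two_ne_zero
        exact_mod_cast h1
      · obtain ⟨k, hk⟩ := ENNReal.exists_nat_gt htop
        refine le_trans ?_ (le_iSup _ (max k N))
        rw [hNk _ (le_max_right _ _), min_eq_left]
        exact hk.le.trans (Nat.cast_le.2 (le_max_left _ _))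
    · apply iSup_le
      intro n
      gcongr
      exact hle n x
  have : ∫⁻ x, T x ^ 2 ∂μ ≤ M ^ 2 := by
    calc _ = ∫⁻ x, ⨆ n, Tn n x ^ 2 ∂μ := lintegral_congr hsup
      _ = ⨆ n, ∫⁻ x, Tn n x ^ 2 ∂μ := by
          apply lintegral_iSup (fun n => (hm n).pow_const 2)
          intro n k hnk x
          exact pow_le_pow_left₀ zero_le (hmono hnk x) 2
      _ ≤ _ := iSup_le hn
  calc _ ≤ (M ^ 2) ^ (1/2 : ℝ) := by gcongr
    _ = M := by rw [← ENNReal.rpow_natCast, ← ENNReal.rpow_mul]; simp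
noncomputable def s0 (γ : ℝ) (p : ℝ × ℝ) : ℝ := p.1 + γ * |p.2| * p.2
noncomputable def s1 (p : ℝ × ℝ) : ℝ := p.1 + p.2 ^ 2
noncomputable def s2 (p : ℝ × ℝ) : ℝ := p.1 - p.2 ^ 2

@[fun_prop] lemma s0_meas (γ : ℝ) : Measurable (s0 γ) := by unfold s0; fun_prop
@[fun_prop] lemma s1_meas : Measurable s1 := by unfold s1; fun_prop
@[fun_prop] lemma s2_meas : Measurable s2 := by unfold s2; fun_prop

noncomputable def kap (γ b : ℝ) (p q : ℝ × ℝ) : ℝ≥0∞ :=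
  ENNReal.ofReal (√|p.2|) * W (-(1-2*b)) (s0 γ p) * W (-b) (s1 q) * W (-b) (s2 (p - q))

lemma kap_sq (γ b : ℝ) (p q : ℝ × ℝ) : kap γ b p q ^ 2 =
    ENNReal.ofReal |p.2| * W (-(2*(1-2*b))) (s0 γ p) * W (-(2*b)) (s1 q)
      * W (-(2*b)) (s2 (p - q)) := by
  have hW : ∀ e x : ℝ, W (-e) x ^ 2 = W (-(2*e)) x := by
    intro e x; rw [sq, W_mul]; congr 1; ring
  unfold kap
  rw [mul_pow, mul_pow, mul_pow, hW, hW, hW, ← ENNReal.ofReal_pow (Real.sqrt_nonneg _),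
    Real.sq_sqrt (abs_nonneg _)]

lemma shear (f : ℝ × ℝ → ℝ≥0∞) (hf : Measurable f) (φ : ℝ → ℝ) :
    ∫⁻ p, f p = ∫⁻ z, ∫⁻ x, f (x - φ z, z) := by
  rw [Measure.volume_eq_prod, lintegral_prod_symm' _ hf]
  apply lintegral_congr
  intro z
  exact (lintegral_sub_right_eq_self (fun x => f (x, z)) (φ z)).symm

lemma boundA (b : ℝ) (hb' : b < 1/2) :
    ∃ C : ℝ≥0∞, C ≠ ⊤ ∧ ∀ (p : ℝ × ℝ) (R : ℝ), 0 ≤ R →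
      ∫⁻ q : ℝ × ℝ, ENNReal.ofReal |p.2| * (psi (2*b) R (s1 q) * psi (2*b) R (s2 (p - q)))
        ≤ C * W (2*(1-2*b)) R := by
  obtain ⟨C, hC, h⟩ := caseA b hb'
  refine ⟨C, hC, fun p R hR => ?_⟩
  rw [shear _ (by fun_prop) (fun z => z^2)]
  refine le_trans (le_of_eq ?_) (h p.2 (p.1 - p.2^2) R hR)
  apply lintegral_congr; intro z
  apply lintegral_congr; intro x
  simp only [s1, s2, Prod.fst_sub, Prod.snd_sub]
  congr 3 <;> ring

lemma boundB (δ b : ℝ) (ha : 1 + δ ≠ 0) (hb : 1/4 < b) (hb' : b < 1/2) :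
    ∃ C : ℝ≥0∞, C ≠ ⊤ ∧ ∀ q : ℝ × ℝ,
      ∫⁻ p : ℝ × ℝ, ENNReal.ofReal |p.2| * (psi (2*(1-2*b)) |s1 q| (p.1 + δ * p.2^2) *
        psi (2*b) |s1 q| (s2 (p - q))) ≤ C * W (2*b) (s1 q) := by
  obtain ⟨C, hC, h⟩ := caseB (1+δ) b ha hb hb'
  refine ⟨C, hC, fun q => ?_⟩
  rw [shear _ (by fun_prop) (fun z => δ * z^2)]
  refine le_trans (le_of_eq ?_) (h q.2 (s1 q))
  apply lintegral_congr; intro z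
  apply lintegral_congr; intro x
  simp only [s1, s2, Prod.fst_sub, Prod.snd_sub]
  congr 3 <;> ring

lemma boundC (δ b : ℝ) (ha : δ - 1 ≠ 0) (hb : 1/4 < b) (hb' : b < 1/2) :
    ∃ C : ℝ≥0∞, C ≠ ⊤ ∧ ∀ r : ℝ × ℝ,
      ∫⁻ p : ℝ × ℝ, ENNReal.ofReal |p.2| * (psi (2*(1-2*b)) |s2 r| (p.1 + δ * p.2^2) *
        psi (2*b) |s2 r| (s1 (p - r))) ≤ C * W (2*b) (s2 r) := by
  obtain ⟨C, hC, h⟩ := caseB (δ-1) b ha hb hb'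
  refine ⟨C, hC, fun q => ?_⟩
  rw [shear _ (by fun_prop) (fun z => δ * z^2)]
  refine le_trans (le_of_eq ?_) (h (-q.2) (s2 q))
  apply lintegral_congr; intro z
  apply lintegral_congr; intro x
  simp only [s1, s2, Prod.fst_sub, Prod.snd_sub]
  congr 3 <;> ring

lemma psi_s0 (e R γ : ℝ) (p : ℝ × ℝ) :
    psi e R (s0 γ p) ≤ psi e R (p.1 + γ * p.2^2) + psi e R (p.1 + (-γ) * p.2^2) := by
  unfold s0
  rcases le_total 0 p.2 with h | h
  · have : p.1 + γ * |p.2| * p.2 = p.1 + γ * p.2^2 := by rw [abs_of_nonneg h]; ring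
    rw [this]; exact le_self_add
  · have : p.1 + γ * |p.2| * p.2 = p.1 + (-γ) * p.2^2 := by rw [abs_of_nonpos h]; ring
    rw [this]; exact le_add_self

noncomputable def ind (x y z : ℝ) : ℝ≥0∞ := if |x| ≤ |z| ∧ |y| ≤ |z| then 1 else 0

lemma ind_meas : Measurable fun t : ℝ × ℝ × ℝ => ind t.1 t.2.1 t.2.2 := by
  unfold ind
  apply Measurable.ite _ (by fun_prop) (by fun_prop)
  have h1 : MeasurableSet {t : ℝ × ℝ × ℝ | |t.1| ≤ |t.2.2|} :=
    measurableSet_le (by fun_prop) (by fun_prop)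
  have h2 : MeasurableSet {t : ℝ × ℝ × ℝ | |t.2.1| ≤ |t.2.2|} :=
    measurableSet_le (by fun_prop) (by fun_prop)
  exact h1.inter h2

@[fun_prop] lemma ind_meas' {α : Type*} [MeasurableSpace α] (f g h : α → ℝ) (hf : Measurable f)
    (hg : Measurable g) (hh : Measurable h) : Measurable fun a => ind (f a) (g a) (h a) :=
  ind_meas.comp (hf.prodMk (hg.prodMk hh))

lemma ind_psi (x y z e e' : ℝ) :
    ind x y z ^ 2 * (W (-e) x * W (-e') y) = psi e |z| x * psi e' |z| y := by
  unfold ind psi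
  by_cases h1 : |x| ≤ |z| <;> by_cases h2 : |y| ≤ |z| <;> simp [h1, h2]

lemma ind_sum (x y z : ℝ) : 1 ≤ ind y z x + ind x z y + ind x y z := by
  unfold ind
  have : (|y| ≤ |x| ∧ |z| ≤ |x|) ∨ (|x| ≤ |y| ∧ |z| ≤ |y|) ∨ (|x| ≤ |z| ∧ |y| ≤ |z|) := by
    rcases le_total |x| |y| with h1 | h1 <;> rcases le_total |y| |z| with h2 | h2 <;>
      rcases le_total |x| |z| with h3 | h3 <;> grind
  rcases this with h | h | h
  · rw [if_pos h, add_assoc]; exact le_self_add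
  · rw [if_pos h]; exact le_add_right le_add_self
  · rw [if_pos h]; exact le_add_self

lemma kA (γ b : ℝ) (hb' : b < 1/2) :
    ∃ C : ℝ≥0∞, C ≠ ⊤ ∧ ∀ p : ℝ × ℝ,
      ∫⁻ q, (ind (s1 q) (s2 (p-q)) (s0 γ p) * kap γ b p q) ^ 2 ≤ C := by
  obtain ⟨C, hC, h⟩ := boundA b hb'
  refine ⟨C, hC, fun p => ?_⟩
  have e1 : W (2*(1-2*b)) |s0 γ p| = W (2*(1-2*b)) (s0 γ p) := by simp [W, jb]
  calc _ = ∫⁻ q, W (-(2*(1-2*b))) (s0 γ p) * (ENNReal.ofReal |p.2| *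
          (psi (2*b) |s0 γ p| (s1 q) * psi (2*b) |s0 γ p| (s2 (p - q)))) := by
        apply lintegral_congr; intro q
        rw [mul_pow, kap_sq, ← ind_psi]; ring
    _ = W (-(2*(1-2*b))) (s0 γ p) * ∫⁻ q, (ENNReal.ofReal |p.2| *
          (psi (2*b) |s0 γ p| (s1 q) * psi (2*b) |s0 γ p| (s2 (p - q)))) :=
        lintegral_const_mul _ (by fun_prop)
    _ ≤ W (-(2*(1-2*b))) (s0 γ p) * (C * W (2*(1-2*b)) |s0 γ p|) := by
        gcongr; exact h p _ (abs_nonneg _)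
    _ = C * (W (-(2*(1-2*b))) (s0 γ p) * W (2*(1-2*b)) (s0 γ p)) := by rw [e1]; ring
    _ = C := by rw [W_mul, neg_add_cancel, W_zero, mul_one]

lemma kB (γ b : ℝ) (h1 : 1 + γ ≠ 0) (h2 : 1 + -γ ≠ 0) (hb : 1/4 < b) (hb' : b < 1/2) :
    ∃ C : ℝ≥0∞, C ≠ ⊤ ∧ ∀ q : ℝ × ℝ,
      ∫⁻ p, (ind (s0 γ p) (s2 (p-q)) (s1 q) * kap γ b p q) ^ 2 ≤ C := by
  obtain ⟨C, hC, h⟩ := boundB γ b h1 hb hb'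
  obtain ⟨C', hC', h'⟩ := boundB (-γ) b h2 hb hb'
  refine ⟨C + C', by finiteness, fun q => ?_⟩
  calc _ ≤ ∫⁻ p, W (-(2*b)) (s1 q) * (ENNReal.ofReal |p.2| *
          (psi (2*(1-2*b)) |s1 q| (p.1 + γ * p.2^2) * psi (2*b) |s1 q| (s2 (p - q)))
          + ENNReal.ofReal |p.2| *
          (psi (2*(1-2*b)) |s1 q| (p.1 + (-γ) * p.2^2) * psi (2*b) |s1 q| (s2 (p - q)))) := by
        apply lintegral_mono; intro p
        simp only
        rw [mul_pow, kap_sq, ← mul_add, ← add_mul]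
        calc _ = W (-(2*b)) (s1 q) * (ENNReal.ofReal |p.2| * (psi (2*(1-2*b)) |s1 q| (s0 γ p) *
                psi (2*b) |s1 q| (s2 (p - q)))) := by rw [← ind_psi]; ring
          _ ≤ _ := by
            gcongr
            exact psi_s0 _ _ _ _
    _ ≤ W (-(2*b)) (s1 q) * (C * W (2*b) (s1 q) + C' * W (2*b) (s1 q)) := by
        rw [lintegral_const_mul _ (by fun_prop), lintegral_add_left (by fun_prop)]
        gcongr
        · exact h q
        · exact h' q
    _ = (C + C') * (W (-(2*b)) (s1 q) * W (2*b) (s1 q)) := by ring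
    _ = C + C' := by rw [W_mul, neg_add_cancel, W_zero, mul_one]

lemma kC (γ b : ℝ) (h1 : γ - 1 ≠ 0) (h2 : -γ - 1 ≠ 0) (hb : 1/4 < b) (hb' : b < 1/2) :
    ∃ C : ℝ≥0∞, C ≠ ⊤ ∧ ∀ r : ℝ × ℝ,
      ∫⁻ p, (ind (s0 γ p) (s1 (p-r)) (s2 r) * kap γ b p (p-r)) ^ 2 ≤ C := by
  obtain ⟨C, hC, h⟩ := boundC γ b h1 hb hb'
  obtain ⟨C', hC', h'⟩ := boundC (-γ) b h2 hb hb'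
  refine ⟨C + C', by finiteness, fun q => ?_⟩
  calc _ ≤ ∫⁻ p, W (-(2*b)) (s2 q) * (ENNReal.ofReal |p.2| *
          (psi (2*(1-2*b)) |s2 q| (p.1 + γ * p.2^2) * psi (2*b) |s2 q| (s1 (p - q)))
          + ENNReal.ofReal |p.2| *
          (psi (2*(1-2*b)) |s2 q| (p.1 + (-γ) * p.2^2) * psi (2*b) |s2 q| (s1 (p - q)))) := by
        apply lintegral_mono; intro p
        simp only
        rw [mul_pow, kap_sq, ← mul_add, ← add_mul, _root_.sub_sub_cancel]
        calc _ = W (-(2*b)) (s2 q) * (ENNReal.ofReal |p.2| * (psi (2*(1-2*b)) |s2 q| (s0 γ p) *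
                psi (2*b) |s2 q| (s1 (p - q)))) := by rw [← ind_psi]; ring
          _ ≤ _ := by
            gcongr
            exact psi_s0 _ _ _ _
    _ ≤ W (-(2*b)) (s2 q) * (C * W (2*b) (s2 q) + C' * W (2*b) (s2 q)) := by
        rw [lintegral_const_mul _ (by fun_prop), lintegral_add_left (by fun_prop)]
        gcongr
        · exact h q
        · exact h' q
    _ = (C + C') * (W (-(2*b)) (s2 q) * W (2*b) (s2 q)) := by ring
    _ = C + C' := by rw [W_mul, neg_add_cancel, W_zero, mul_one]

@[fun_prop] lemma kap_meas {α : Type*} [MeasurableSpace α] (γ b : ℝ) (f g : α → ℝ × ℝ)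
    (hf : Measurable f) (hg : Measurable g) : Measurable fun a => kap γ b (f a) (g a) := by
  unfold kap; fun_prop

lemma sq_right (u v : ℝ × ℝ → ℝ≥0∞) (hu : Measurable u) (hv : Measurable v) :
    ∫⁻ q, ∫⁻ p, (u p * v (p - q)) ^ 2 = (∫⁻ p, u p ^ 2) * ∫⁻ p, v p ^ 2 := by
  rw [lintegral_lintegral_swap (by fun_prop)]
  rw [← lintegral_mul_const _ (by fun_prop)]
  apply lintegral_congr; intro p
  simp only [mul_pow]
  rw [lintegral_const_mul _ (by fun_prop), lintegral_sub_left_eq_self (fun q => v q ^ 2) p]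

lemma sq_left (u v : ℝ × ℝ → ℝ≥0∞) (hu : Measurable u) (hv : Measurable v) :
    ∫⁻ p, ∫⁻ q, (u q * v (p - q)) ^ 2 = (∫⁻ p, u p ^ 2) * ∫⁻ p, v p ^ 2 := by
  rw [lintegral_lintegral_swap (by fun_prop)]
  rw [← lintegral_mul_const _ (by fun_prop)]
  apply lintegral_congr; intro q
  simp only [mul_pow]
  rw [lintegral_const_mul _ (by fun_prop), lintegral_sub_right_eq_self (fun p => v p ^ 2) q]

lemma core (γ b : ℝ) (hγ1 : |γ| ≠ 1) (hb : 1/4 < b) (hb' : b < 1/2) :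
    ∃ C : ℝ≥0∞, C ≠ ⊤ ∧ ∀ f g : ℝ × ℝ → ℝ≥0∞, Measurable f → Measurable g →
      (∫⁻ p, (∫⁻ q, kap γ b p q * (f q * g (p - q))) ^ 2) ^ (1/2 : ℝ) ≤
        C * ((∫⁻ p, f p ^ 2) ^ (1/2 : ℝ) * (∫⁻ p, g p ^ 2) ^ (1/2 : ℝ)) := by
  have n1 : γ ≠ 1 := fun h => hγ1 (by simp [h])
  have n2 : γ ≠ -1 := fun h => hγ1 (by simp [h])
  obtain ⟨A, hA, hA'⟩ := kA γ b hb'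
  obtain ⟨B, hB, hB'⟩ := kB γ b (fun h => n2 (by linarith)) (fun h => n1 (by linarith)) hb hb'
  obtain ⟨D, hD, hD'⟩ := kC γ b (fun h => n1 (by linarith)) (fun h => n2 (by linarith)) hb hb'
  refine ⟨A ^ (1/2 : ℝ) + B ^ (1/2 : ℝ) + D ^ (1/2 : ℝ), by finiteness, ?_⟩
  intro f g hf hg
  have hT : Measurable fun p => ∫⁻ q, kap γ b p q * (f q * g (p - q)) :=
    Measurable.lintegral_prod_right'
      (f := fun z : (ℝ × ℝ) × (ℝ × ℝ) => kap γ b z.1 z.2 * (f z.2 * g (z.1 - z.2))) (by fun_prop)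
  apply duality _ _ hT
  intro H hH
  have tA := trilin volume volume H (fun p q => ind (s1 q) (s2 (p-q)) (s0 γ p) * kap γ b p q)
    (fun p q => f q * g (p - q)) A hH (by unfold Function.uncurry; fun_prop)
    (by unfold Function.uncurry; fun_prop) hA'
  have tB := trilin volume volume f (fun q p => ind (s0 γ p) (s2 (p-q)) (s1 q) * kap γ b p q)
    (fun q p => H p * g (p - q)) B hf (by unfold Function.uncurry; fun_prop)
    (by unfold Function.uncurry; fun_prop) hB'
  have tC := trilin volume volume g (fun r p => ind (s0 γ p) (s1 (p-r)) (s2 r) * kap γ b p (p-r))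
    (fun r p => H p * f (p - r)) D hg (by unfold Function.uncurry; fun_prop)
    (by unfold Function.uncurry; fun_prop) hD'
  rw [sq_left f g hf hg, ENNReal.mul_rpow_of_nonneg _ _ (by norm_num)] at tA
  rw [sq_right H g hH hg, ENNReal.mul_rpow_of_nonneg _ _ (by norm_num),
    lintegral_lintegral_swap (by fun_prop)] at tB
  rw [sq_right H f hH hf, ENNReal.mul_rpow_of_nonneg _ _ (by norm_num),
    lintegral_lintegral_swap (by fun_prop)] at tC
  have eC : ∀ p, ∫⁻ r, g r * (ind (s0 γ p) (s1 (p-r)) (s2 r) * kap γ b p (p-r) *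
      (H p * f (p - r))) = ∫⁻ q, g (p - q) * (ind (s0 γ p) (s1 q) (s2 (p - q)) * kap γ b p q *
      (H p * f q)) := by
    intro p
    rw [← lintegral_sub_left_eq_self _ p]
    simp only [_root_.sub_sub_cancel]
  simp only [eC] at tC
  set nf := (∫⁻ p, f p ^ 2) ^ (1/2 : ℝ)
  set ng := (∫⁻ p, g p ^ 2) ^ (1/2 : ℝ)
  set nH := (∫⁻ p, H p ^ 2) ^ (1/2 : ℝ)
  have hLA : Measurable fun p => ∫⁻ q, H p * (ind (s1 q) (s2 (p-q)) (s0 γ p) * kap γ b p q *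
      (f q * g (p - q))) :=
    Measurable.lintegral_prod_right'
      (f := fun z : (ℝ × ℝ) × (ℝ × ℝ) => H z.1 * (ind (s1 z.2) (s2 (z.1-z.2)) (s0 γ z.1) *
        kap γ b z.1 z.2 * (f z.2 * g (z.1 - z.2)))) (by fun_prop)
  have hLB : Measurable fun p => ∫⁻ q, f q * (ind (s0 γ p) (s2 (p-q)) (s1 q) * kap γ b p q *
      (H p * g (p - q))) :=
    Measurable.lintegral_prod_right'
      (f := fun z : (ℝ × ℝ) × (ℝ × ℝ) => f z.2 * (ind (s0 γ z.1) (s2 (z.1-z.2)) (s1 z.2) *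
        kap γ b z.1 z.2 * (H z.1 * g (z.1 - z.2)))) (by fun_prop)
  calc _ ≤ ∫⁻ p, ((∫⁻ q, H p * (ind (s1 q) (s2 (p-q)) (s0 γ p) * kap γ b p q *
          (f q * g (p - q)))) + (∫⁻ q, f q * (ind (s0 γ p) (s2 (p-q)) (s1 q) * kap γ b p q *
          (H p * g (p - q)))) + ∫⁻ q, g (p - q) * (ind (s0 γ p) (s1 q) (s2 (p - q)) *
          kap γ b p q * (H p * f q))) := by
        apply lintegral_mono; intro p
        simp only
        rw [← lintegral_mul_const _ (by fun_prop), ← lintegral_add_left (by fun_prop),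
          ← lintegral_add_left (by fun_prop)]
        apply lintegral_mono; intro q
        simp only
        calc _ = 1 * (kap γ b p q * (f q * g (p - q)) * H p) := (one_mul _).symm
          _ ≤ _ := mul_le_mul_left (ind_sum (s0 γ p) (s1 q) (s2 (p-q))) _
          _ = _ := by ring
    _ ≤ A ^ (1/2 : ℝ) * (nH * (nf * ng)) + B ^ (1/2 : ℝ) * (nf * (nH * ng)) +
        D ^ (1/2 : ℝ) * (ng * (nH * nf)) := by
        refine (le_of_eq (lintegral_add_left (hLA.add hLB) _)).trans ?_
        refine add_le_add ((le_of_eq (lintegral_add_left hLA _)).trans (add_le_add tA tB)) tC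
    _ = _ := by ring
lemma mink (f g : ℝ × ℝ → ℝ≥0∞) (hf : Measurable f) (hg : Measurable g) :
    (∫⁻ p, (f p + g p) ^ 2) ^ (1/2 : ℝ) ≤
      (∫⁻ p, f p ^ 2) ^ (1/2 : ℝ) + (∫⁻ p, g p ^ 2) ^ (1/2 : ℝ) := by
  have := ENNReal.lintegral_Lp_add_le (μ := (volume : Measure (ℝ × ℝ))) (p := 2)
    hf.aemeasurable hg.aemeasurable (by norm_num)
  simpa using this

lemma jb_split (s x y : ℝ) (hs : 0 ≤ s) : jb (x + y) ^ s ≤ 2 ^ s * (jb x ^ s + jb y ^ s) := by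
  have hx := jb_pos x
  have hy := jb_pos y
  have key : ∀ u v : ℝ, jb u ≤ jb v → (jb u + jb v) ^ s ≤ 2 ^ s * (jb v ^ s) := by
    intro u v h
    have := jb_pos u
    have := jb_pos v
    rw [← Real.mul_rpow (by norm_num) (by positivity)]
    exact Real.rpow_le_rpow (by positivity) (by linarith) hs
  have h1 : jb (x + y) ^ s ≤ (jb x + jb y) ^ s :=
    Real.rpow_le_rpow (jb_pos _).le (jb_add x y) hs
  have a1 : 0 ≤ (2:ℝ) ^ s * jb x ^ s := by positivity
  have a2 : 0 ≤ (2:ℝ) ^ s * jb y ^ s := by positivity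
  rcases le_total (jb x) (jb y) with h | h
  · have := key x y h; linarith
  · have := key y x h; rw [add_comm (jb y)] at this; linarith

lemma pt_kernel (γ b c s : ℝ) (hc : 1 - 2*b ≤ c) (hs : 0 ≤ s) (p q : ℝ × ℝ) (x y : ℝ)
    (hx : 0 ≤ x) (hy : 0 ≤ y) :
    ENNReal.ofReal (|p.2| * jb p.2 ^ (s - 1/2) * jb (p.1 + γ * |p.2| * p.2) ^ (-c))
      * ENNReal.ofReal (x * y) ≤ ENNReal.ofReal (2^s) *
      (kap γ b p q * (ENNReal.ofReal (jb q.2 ^ s * jb (q.1 + q.2^2) ^ b * x) *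
          ENNReal.ofReal (jb ((p-q).1 - (p-q).2^2) ^ b * y))
      + kap γ b p q * (ENNReal.ofReal (jb (q.1 + q.2^2) ^ b * x) *
          ENNReal.ofReal (jb (p-q).2 ^ s * jb ((p-q).1 - (p-q).2^2) ^ b * y))) := by
  have P := jb_pos
  have hS : jb p.2 ^ s ≤ 2^s * (jb q.2 ^ s + jb (p-q).2 ^ s) := by
    have := jb_split s q.2 (p-q).2 hs
    rwa [show q.2 + (p-q).2 = p.2 by simp] at this
  have hX : |p.2| * jb p.2 ^ (s - 1/2) ≤ √|p.2| * jb p.2 ^ s := by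
    have h1 : jb p.2 ^ (s - 1/2) = jb p.2 ^ s * (√(jb p.2))⁻¹ := by
      rw [sub_eq_add_neg, Real.rpow_add (P _), Real.rpow_neg (P _).le, ← Real.sqrt_eq_rpow]
    have h2 : |p.2| = √|p.2| * √|p.2| := (Real.mul_self_sqrt (abs_nonneg _)).symm
    have h3 : √|p.2| ≤ √(jb p.2) := Real.sqrt_le_sqrt (by unfold jb; linarith)
    have h4 : 0 < √(jb p.2) := Real.sqrt_pos.2 (P _)
    have h5 : √|p.2| * (√(jb p.2))⁻¹ ≤ 1 := by
      rw [← div_eq_mul_inv]; exact (div_le_one h4).2 h3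
    have h6 : 0 ≤ √|p.2| * jb p.2 ^ s := by have := P p.2; positivity
    rw [h1]
    calc |p.2| * (jb p.2 ^ s * (√(jb p.2))⁻¹)
        = (√|p.2| * jb p.2 ^ s) * (√|p.2| * (√(jb p.2))⁻¹) := by
          nth_rewrite 1 [h2]; ring
      _ ≤ (√|p.2| * jb p.2 ^ s) * 1 := mul_le_mul_of_nonneg_left h5 h6
      _ = _ := mul_one _
  have hY : jb (p.1 + γ * |p.2| * p.2) ^ (-c) ≤ jb (p.1 + γ * |p.2| * p.2) ^ (-(1-2*b)) :=
    Real.rpow_le_rpow_of_exponent_le (jb_ge _) (by linarith)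
  unfold kap W s0 s1 s2
  set A := jb (p.1 + γ * |p.2| * p.2)
  set B := jb (q.1 + q.2^2)
  set D := jb ((p-q).1 - (p-q).2^2)
  have hA : 0 < A := P _
  have hB : 0 < B := P _
  have hD : 0 < D := P _
  have hp := P p.2
  have hq := P q.2
  have hr := P (p-q).2
  have eB : B ^ (-b) * B ^ b = 1 := by rw [← Real.rpow_add hB]; simp
  have eD : D ^ (-b) * D ^ b = 1 := by rw [← Real.rpow_add hD]; simp
  have e2 : (0:ℝ) ≤ 2 ^ s := by positivity
  have k1 : 0 ≤ √|p.2| * A ^ (-(1-2*b)) := by positivity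
  have k2 : 0 ≤ √|p.2| * A ^ (-(1-2*b)) * B ^ (-b) := by positivity
  have k3 : 0 ≤ √|p.2| * A ^ (-(1-2*b)) * B ^ (-b) * D ^ (-b) := by positivity
  have i1 : 0 ≤ jb q.2 ^ s * B ^ b * x := by positivity
  have i2 : 0 ≤ B ^ b * x := by positivity
  have j0 : 0 ≤ |p.2| * jb p.2 ^ (s - 1/2) * A ^ (-c) := by positivity
  rw [← ENNReal.ofReal_mul j0, ← ENNReal.ofReal_mul (Real.sqrt_nonneg _),
    ← ENNReal.ofReal_mul k1, ← ENNReal.ofReal_mul k2, ← ENNReal.ofReal_mul i1,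
    ← ENNReal.ofReal_mul i2, ← ENNReal.ofReal_mul k3, ← ENNReal.ofReal_mul k3,
    ← ENNReal.ofReal_add (by positivity) (by positivity), ← ENNReal.ofReal_mul e2]
  apply ENNReal.ofReal_le_ofReal
  calc |p.2| * jb p.2 ^ (s - 1/2) * A ^ (-c) * (x * y)
      ≤ (√|p.2| * (2^s * (jb q.2 ^ s + jb (p-q).2 ^ s))) * A ^ (-(1-2*b)) * (x * y) := by
        have : |p.2| * jb p.2 ^ (s - 1/2) ≤ √|p.2| * (2^s * (jb q.2 ^ s + jb (p-q).2 ^ s)) :=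
          hX.trans (mul_le_mul_of_nonneg_left hS (Real.sqrt_nonneg _))
        gcongr
    _ = (√|p.2| * (2^s * (jb q.2 ^ s + jb (p-q).2 ^ s))) * A ^ (-(1-2*b)) * (x * y) *
        ((B ^ (-b) * B ^ b) * (D ^ (-b) * D ^ b)) := by rw [eB, eD]; ring
    _ = _ := by ring

/-- Fourier-side formulation of
`‖∂ₓ(u v̄)‖_{Y_γ^{s−1/2,−c}} ≲ ‖u‖_{X^{s,b₁}}‖v‖_{X^{0,b₁}} + ‖u‖_{X^{0,b₁}}‖v‖_{X^{s,b₁}}`,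
with `F = û` and `G` the space-time Fourier transform of `v̄`.
Points of `ℝ²` are `p = (τ, ξ)`. -/
theorem bilinear_estimate_Ys (γ b₁ c s : ℝ) (hγ : γ ≠ 0) (hγ1 : |γ| ≠ 1)
    (hb₁ : b₁ ∈ Set.Ioo (1/4 : ℝ) (1/2)) (hc : c ∈ Set.Ioo (1/4 : ℝ) (1/2))
    (hsum : 1 ≤ 2 * b₁ + c) (hs : 0 ≤ s) :
    ∃ C : ℝ, 0 < C ∧ ∀ F G : ℝ × ℝ → ℝ,
      Measurable F → Measurable G → (∀ p, 0 ≤ F p) → (∀ p, 0 ≤ G p) →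
      (∫⁻ p : ℝ × ℝ,
          (ENNReal.ofReal (|p.2| * jb p.2 ^ (s - 1/2) * jb (p.1 + γ * |p.2| * p.2) ^ (-c))
            * convR2 F G p) ^ 2) ^ (1/2 : ℝ)
      ≤ ENNReal.ofReal C *
        (l2R2 (fun p => jb p.2 ^ s * jb (p.1 + p.2 ^ 2) ^ b₁ * F p) *
           l2R2 (fun p => jb (p.1 - p.2 ^ 2) ^ b₁ * G p)
         + l2R2 (fun p => jb (p.1 + p.2 ^ 2) ^ b₁ * F p) *
           l2R2 (fun p => jb p.2 ^ s * jb (p.1 - p.2 ^ 2) ^ b₁ * G p)) := by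
  obtain ⟨C, hC, h⟩ := core γ b₁ hγ1 hb₁.1 hb₁.2
  have hfin : ENNReal.ofReal (2^s) * C ≠ ⊤ := by finiteness
  refine ⟨(ENNReal.ofReal (2^s) * C).toReal + 1, by positivity, ?_⟩
  intro F G hF hG hF0 hG0
  set f : ℝ × ℝ → ℝ≥0∞ := fun p => ENNReal.ofReal (jb (p.1 + p.2 ^ 2) ^ b₁ * F p) with hf
  set fs : ℝ × ℝ → ℝ≥0∞ :=
    fun p => ENNReal.ofReal (jb p.2 ^ s * jb (p.1 + p.2 ^ 2) ^ b₁ * F p) with hfs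
  set g : ℝ × ℝ → ℝ≥0∞ := fun p => ENNReal.ofReal (jb (p.1 - p.2 ^ 2) ^ b₁ * G p) with hg
  set gs : ℝ × ℝ → ℝ≥0∞ :=
    fun p => ENNReal.ofReal (jb p.2 ^ s * jb (p.1 - p.2 ^ 2) ^ b₁ * G p) with hgs
  have mf : Measurable f := by fun_prop
  have mfs : Measurable fs := by fun_prop
  have mg : Measurable g := by fun_prop
  have mgs : Measurable gs := by fun_prop
  have hT : ∀ u v : ℝ × ℝ → ℝ≥0∞, Measurable u → Measurable v →
      Measurable fun p => ∫⁻ q, kap γ b₁ p q * (u q * v (p - q)) := fun u v hu hv =>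
    Measurable.lintegral_prod_right'
      (f := fun z : (ℝ × ℝ) × (ℝ × ℝ) => kap γ b₁ z.1 z.2 * (u z.2 * v (z.1 - z.2)))
      (by fun_prop)
  set T1 := fun p => ∫⁻ q, kap γ b₁ p q * (fs q * g (p - q)) with hT1
  set T2 := fun p => ∫⁻ q, kap γ b₁ p q * (f q * gs (p - q)) with hT2
  have mT1 : Measurable T1 := hT _ _ mfs mg
  have mT2 : Measurable T2 := hT _ _ mf mgs
  have hpt : ∀ p : ℝ × ℝ, ENNReal.ofReal (|p.2| * jb p.2 ^ (s - 1/2) *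
      jb (p.1 + γ * |p.2| * p.2) ^ (-c)) * convR2 F G p ≤
      ENNReal.ofReal (2^s) * (T1 p + T2 p) := by
    intro p
    simp only [convR2, hT1, hT2]
    rw [← lintegral_add_left (by fun_prop), ← lintegral_const_mul _ (by fun_prop),
      ← lintegral_const_mul _ (by fun_prop)]
    apply lintegral_mono; intro q
    exact pt_kernel γ b₁ c s (by linarith) hs p q (F q) (G (p - q)) (hF0 _) (hG0 _)
  calc _ ≤ (∫⁻ p, (ENNReal.ofReal (2^s) * (T1 p + T2 p)) ^ 2) ^ (1/2 : ℝ) := by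
        apply ENNReal.rpow_le_rpow _ (by norm_num)
        apply lintegral_mono
        intro p
        exact pow_le_pow_left₀ zero_le (hpt p) 2
    _ = ENNReal.ofReal (2^s) * (∫⁻ p, (T1 p + T2 p) ^ 2) ^ (1/2 : ℝ) := by
        simp only [mul_pow]
        rw [lintegral_const_mul _ (by fun_prop), ENNReal.mul_rpow_of_nonneg _ _ (by norm_num),
          ← ENNReal.rpow_natCast, ← ENNReal.rpow_mul]
        simp
    _ ≤ ENNReal.ofReal (2^s) * (C * (l2R2 (fun p => jb p.2 ^ s * jb (p.1 + p.2 ^ 2) ^ b₁ * F p) *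
           l2R2 (fun p => jb (p.1 - p.2 ^ 2) ^ b₁ * G p))
         + C * (l2R2 (fun p => jb (p.1 + p.2 ^ 2) ^ b₁ * F p) *
           l2R2 (fun p => jb p.2 ^ s * jb (p.1 - p.2 ^ 2) ^ b₁ * G p))) := by
        gcongr
        exact (mink T1 T2 mT1 mT2).trans (add_le_add (h fs g mfs mg) (h f gs mf mgs))
    _ ≤ _ := by
        rw [← mul_add, ← mul_assoc]
        gcongr
        rw [ENNReal.ofReal_add (by positivity) (by norm_num), ENNReal.ofReal_toReal hfin]
        exact le_self_add
end

section
/- Let γ ∈ ℝ with γ ≠ 0 and |γ| ≠ 1, and let b > 1/4. Then there exists a constant C > 0 such that for every Schwartz function u : ℝ² → ℂ in the variables (t,x): (i) ‖u‖_{L³(ℝ²)} ≤ C ( ∫_{ℝ²} ⟨τ+ξ²⟩^{2b} |û(τ,ξ)|² dτ dξ )^{1/2}, and (ii) ‖u‖_{L³(ℝ²)} ≤ C ( ∫_{ℝ²} ⟨τ+γ|ξ|ξ⟩^{2b} |û(τ,ξ)|² dτ dξ )^{1/2}. -/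
open MeasureTheory ENNReal

/-- Space-time Fourier transform `û(τ,ξ) = (2π)⁻¹ ∫ u(t,x) e^{-i(xξ+tτ)} dt dx`,
where points of `ℝ²` are `p = (t, x)`. -/
noncomputable def ft (u : ℝ × ℝ → ℂ) (τ ξ : ℝ) : ℂ :=
  (2 * Real.pi : ℂ)⁻¹ *
    ∫ p : ℝ × ℝ, u p * Complex.exp (-Complex.I * ((p.2 * ξ + p.1 * τ : ℝ) : ℂ))

open FourierTransform in
theorem cont_fourier {V : Type*} [NormedAddCommGroup V] [InnerProductSpace ℝ V]
    [FiniteDimensional ℝ V] [MeasurableSpace V] [BorelSpace V] {h : V → ℂ} (h1 : Integrable h) :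
    Continuous (𝓕 h) :=
  VectorFourier.fourierIntegral_continuous Real.continuous_fourierChar
    (by exact continuous_inner) h1

open FourierTransform in
theorem plancherel_aux {V : Type*} [NormedAddCommGroup V] [InnerProductSpace ℝ V]
    [FiniteDimensional ℝ V] [MeasurableSpace V] [BorelSpace V] {h : V → ℂ}
    (h1 : Integrable h) (h2 : MemLp h 2) : eLpNorm (𝓕 h) 2 = eLpNorm h 2 := by
  set F : Lp (α := V) ℂ 2 volume := 𝓕 (h2.toLp h) with hF
  have key : ∀ᵐ x : V, F x = 𝓕 h x := by
    apply ae_eq_of_integral_contDiff_smul_eq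
    · exact (Lp.memLp F).locallyIntegrable (by norm_num)
    · exact (cont_fourier h1).locallyIntegrable
    · intro g hg hgc
      have hc : HasCompactSupport (fun x => (g x : ℂ)) :=
        hgc.comp_left (g := fun r : ℝ => (r : ℂ)) (by simp)
      let φ : SchwartzMap V ℂ := hc.toSchwartzMap (Complex.ofRealCLM.contDiff.comp hg)
      have hφ : ∀ x, φ x = (g x : ℂ) := fun x => rfl
      have e1 := congrArg (fun T => T φ) (Lp.fourier_toTemperedDistribution_eq (h2.toLp h))
      simp only [TemperedDistribution.fourier_apply, Lp.toTemperedDistribution_apply] at e1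
      have e2 := VectorFourier.integral_fourierIntegral_smul_eq_flip (μ := (volume : Measure V))
        (ν := (volume : Measure V)) (L := innerₗ V)
        Real.continuous_fourierChar (by exact continuous_inner) φ.integrable h1
      have e3 : ∫ x, (𝓕 φ) x • (h2.toLp h) x = ∫ x, (𝓕 φ) x • h x := by
        apply integral_congr_ae
        filter_upwards [h2.coeFn_toLp] with x hx
        rw [hx]
      rw [flip_innerₗ] at e2
      calc ∫ x, g x • F x = ∫ x, φ x • F x := by simp [hφ]
        _ = ∫ x, (𝓕 φ) x • h x := by rw [← e3, e1]
        _ = ∫ x, φ x • 𝓕 h x := e2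
        _ = _ := by simp [hφ]
  rw [← eLpNorm_congr_ae key]
  have := Lp.norm_fourier_eq (h2.toLp h)
  rw [← hF, Lp.norm_def, Lp.norm_def, ENNReal.toReal_eq_toReal_iff' (Lp.eLpNorm_ne_top _) (Lp.eLpNorm_ne_top _)] at this
  rw [this]
  exact eLpNorm_congr_ae h2.coeFn_toLp

theorem vol1 (A c K : ℝ) (hc : c ≠ 0) (hK : 0 ≤ K) :
    volume {η : ℝ | |A + 2 * c * η ^ 2| ≤ 2 * K} ≤ ENNReal.ofReal (2 * Real.sqrt (2 * K / |c|)) := by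
  set L := 2 * K / |c| with hL
  have hc' : 0 < |c| := abs_pos.mpr hc
  have hL0 : 0 ≤ L := by positivity
  set a := -A / (2 * c) - K / |c| with ha
  set r := Real.sqrt (max a 0)
  set s := Real.sqrt L
  have hr : 0 ≤ r := Real.sqrt_nonneg _
  have hs : 0 ≤ s := Real.sqrt_nonneg _
  have hr2 : r ^ 2 = max a 0 := Real.sq_sqrt (le_max_right _ _)
  have hs2 : s ^ 2 = L := Real.sq_sqrt hL0
  have sub : {η : ℝ | |A + 2 * c * η ^ 2| ≤ 2 * K} ⊆ Set.Icc r (r + s) ∪ Set.Icc (-r - s) (-r) := by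
    intro η hη
    simp only [Set.mem_ofPred_eq] at hη
    have h1 : |η ^ 2 - (-A / (2 * c))| ≤ K / |c| := by
      rw [le_div_iff₀ hc', ← abs_mul]
      have : (η ^ 2 - -A / (2 * c)) * c = (A + 2 * c * η ^ 2) / 2 := by field_simp; ring
      rw [this, abs_div, abs_two]; linarith
    rw [abs_le] at h1
    have hLL : L = K / |c| + K / |c| := by rw [hL]; ring
    have h2 : a ≤ η ^ 2 := by linarith
    have h3 : η ^ 2 ≤ a + L := by linarith
    have h4 : r ≤ |η| := by
      rw [← abs_of_nonneg hr, ← sq_le_sq, hr2]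
      exact max_le h2 (sq_nonneg _)
    have h5 : |η| ≤ r + s := by
      rw [← abs_of_nonneg (add_nonneg hr hs), ← sq_le_sq]
      have := le_max_left a 0
      nlinarith [mul_nonneg hr hs]
    rcases le_total 0 η with h | h
    · left; rw [abs_of_nonneg h] at h4 h5; exact ⟨h4, h5⟩
    · right; rw [abs_of_nonpos h] at h4 h5; constructor <;> linarith
  calc _ ≤ volume (Set.Icc r (r + s) ∪ Set.Icc (-r - s) (-r)) := measure_mono sub
    _ ≤ _ := measure_union_le _ _
    _ = _ := by
      rw [Real.volume_Icc, Real.volume_Icc, ← ENNReal.ofReal_add (by linarith) (by linarith)]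
      congr 1; ring

theorem vol2 (c K : ℝ) (hc : c ≠ 0) (hK : 0 ≤ K) (z : ℝ × ℝ) :
    volume {w : ℝ × ℝ | |w.1 + c * w.2 ^ 2| ≤ K ∧ |(z.1 - w.1) + c * (z.2 - w.2) ^ 2| ≤ K} ≤
      ENNReal.ofReal (2 * Real.sqrt (2 * K / |c|)) * ENNReal.ofReal (2 * K) := by
  set T := {w : ℝ × ℝ | |w.1 + c * w.2 ^ 2| ≤ K ∧ |(z.1 - w.1) + c * (z.2 - w.2) ^ 2| ≤ K}
  have hT : MeasurableSet T := by
    apply IsClosed.measurableSet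
    have c1 : IsClosed {w : ℝ × ℝ | |w.1 + c * w.2 ^ 2| ≤ K} :=
      isClosed_le (by fun_prop) (by fun_prop)
    have c2 : IsClosed {w : ℝ × ℝ | |(z.1 - w.1) + c * (z.2 - w.2) ^ 2| ≤ K} :=
      isClosed_le (by fun_prop) (by fun_prop)
    exact c1.inter c2
  set A := z.1 + c * z.2 ^ 2 / 2
  set B := {η : ℝ | |A + 2 * c * η ^ 2| ≤ 2 * K}
  have hB : MeasurableSet B := by
    apply IsClosed.measurableSet
    exact isClosed_le (by fun_prop) (by fun_prop)
  rw [Measure.volume_eq_prod, Measure.prod_apply_symm hT]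
  have h : ∀ y : ℝ, volume ((fun x => (x, y)) ⁻¹' T) ≤
      ((fun y => y + -(z.2 / 2)) ⁻¹' B).indicator (fun _ => ENNReal.ofReal (2 * K)) y := by
    intro y
    by_cases hy : y ∈ ((fun y => y + -(z.2 / 2)) ⁻¹' B)
    · rw [Set.indicator_of_mem hy]
      have : (fun x => (x, y)) ⁻¹' T ⊆ Set.Icc (-K - c * y ^ 2) (K - c * y ^ 2) := by
        intro x hx
        have := abs_le.1 hx.1
        simp only at this
        constructor <;> linarith
      refine (measure_mono this).trans ?_
      rw [Real.volume_Icc]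
      apply ENNReal.ofReal_le_ofReal; linarith
    · have : (fun x => (x, y)) ⁻¹' T = ∅ := by
        ext x
        simp only [Set.mem_preimage, Set.mem_empty_iff_false, iff_false]
        intro hx
        apply hy
        have h1 := abs_le.1 hx.1
        have h2 := abs_le.1 hx.2
        simp only at h1 h2
        change |A + 2 * c * (y + -(z.2 / 2)) ^ 2| ≤ 2 * K
        have : A + 2 * c * (y + -(z.2 / 2)) ^ 2 =
          (x + c * y ^ 2) + (z.1 - x + c * (z.2 - y) ^ 2) := by simp only [A]; ring
        rw [this, abs_le]; constructor <;> linarith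
      rw [this]; simp
  calc _ ≤ ∫⁻ y, ((fun y => y + -(z.2 / 2)) ⁻¹' B).indicator (fun _ => ENNReal.ofReal (2 * K)) y :=
        lintegral_mono h
    _ = ENNReal.ofReal (2 * K) * volume B := by
        rw [lintegral_indicator (hB.preimage (by fun_prop)), setLIntegral_const,
          measure_preimage_add_right]
    _ ≤ _ := by
        rw [mul_comm]; gcongr; exact vol1 A c K hc hK

theorem cs_lint {α : Type*} [MeasurableSpace α] (μ : Measure α) {f g : α → ℝ≥0∞}
    (hf : AEMeasurable f μ) (hg : AEMeasurable g μ) :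
    (∫⁻ a, f a * g a ∂μ) ^ 2 ≤ (∫⁻ a, f a ^ 2 ∂μ) * (∫⁻ a, g a ^ 2 ∂μ) := by
  have := ENNReal.lintegral_mul_le_Lp_mul_Lq μ Real.HolderConjugate.two_two hf hg
  simp only [Pi.mul_apply, ENNReal.rpow_two] at this
  calc _ ≤ ((∫⁻ a, f a ^ 2 ∂μ) ^ (1 / 2 : ℝ) * (∫⁻ a, g a ^ 2 ∂μ) ^ (1 / 2 : ℝ)) ^ 2 := by gcongr
    _ = _ := by
      rw [mul_pow, ← ENNReal.rpow_natCast, ← ENNReal.rpow_natCast, ← ENNReal.rpow_mul,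
        ← ENNReal.rpow_mul]; norm_num

theorem eL2 {α : Type*} [MeasurableSpace α] (μ : Measure α) (f : α → ℂ) :
    eLpNorm f 2 μ ^ 2 = ∫⁻ a, ‖f a‖ₑ ^ 2 ∂μ := by
  rw [eLpNorm_eq_lintegral_rpow_enorm_toReal (by norm_num) (by norm_num), ← ENNReal.rpow_natCast,
    ← ENNReal.rpow_mul]
  simp

theorem conv_bound {V : Type*} [NormedAddCommGroup V] [InnerProductSpace ℝ V]
    [FiniteDimensional ℝ V] [MeasurableSpace V] [BorelSpace V] {g : V → ℂ} (hm : Measurable g)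
    (S : Set V) (hS : MeasurableSet S) (hgS : ∀ x ∉ S, g x = 0)
    (M : ℝ≥0∞) (hM : ∀ z, volume {w : V | w ∈ S ∧ z - w ∈ S} ≤ M) :
    ∫⁻ z, ‖convolution g g (ContinuousLinearMap.mul ℂ ℂ) volume z‖ₑ ^ 2 ≤
      M * (∫⁻ w, ‖g w‖ₑ ^ 2) ^ 2 := by
  have pt : ∀ z, ‖convolution g g (ContinuousLinearMap.mul ℂ ℂ) volume z‖ₑ ^ 2 ≤
      M * ∫⁻ w, ‖g w‖ₑ ^ 2 * ‖g (z - w)‖ₑ ^ 2 := by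
    intro z
    set T := {w : V | w ∈ S ∧ z - w ∈ S} with hT
    have hTm : MeasurableSet T := hS.inter (hS.preimage (by fun_prop))
    have e : ∀ w, ‖g w * g (z - w)‖ₑ = T.indicator 1 w * (‖g w‖ₑ * ‖g (z - w)‖ₑ) := by
      intro w
      by_cases hw : w ∈ T
      · simp [Set.indicator_of_mem hw, enorm_mul]
      · rw [Set.indicator_of_notMem hw]
        by_cases h1 : w ∈ S
        · have h2 : z - w ∉ S := fun h => hw ⟨h1, h⟩
          simp [hgS _ h2]
        · simp [hgS _ h1]
    calc _ ≤ (∫⁻ w, ‖g w * g (z - w)‖ₑ) ^ 2 := by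
          gcongr
          exact enorm_integral_le_lintegral_enorm _
      _ = (∫⁻ w, T.indicator 1 w * (‖g w‖ₑ * ‖g (z - w)‖ₑ)) ^ 2 := by simp_rw [e]
      _ ≤ (∫⁻ w, T.indicator (1 : V → ℝ≥0∞) w ^ 2) * ∫⁻ w, (‖g w‖ₑ * ‖g (z - w)‖ₑ) ^ 2 := by
          apply cs_lint
          · exact (measurable_one.indicator hTm).aemeasurable
          · exact Measurable.aemeasurable (by fun_prop)
      _ ≤ _ := by
          simp_rw [mul_pow]
          gcongr
          refine le_trans (le_of_eq ?_) (hM z)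
          rw [← lintegral_indicator_one hTm]
          congr 1 with w
          by_cases hw : w ∈ T <;> simp [hw]
  calc _ ≤ ∫⁻ z, M * ∫⁻ w, ‖g w‖ₑ ^ 2 * ‖g (z - w)‖ₑ ^ 2 := lintegral_mono pt
    _ = M * ∫⁻ z, ∫⁻ w, ‖g w‖ₑ ^ 2 * ‖g (z - w)‖ₑ ^ 2 := by
        rw [lintegral_const_mul]
        apply Measurable.lintegral_prod_right'
          (f := fun p : V × V => ‖g p.2‖ₑ ^ 2 * ‖g (p.1 - p.2)‖ₑ ^ 2)
        fun_prop
    _ = M * ∫⁻ w, ∫⁻ z, ‖g w‖ₑ ^ 2 * ‖g (z - w)‖ₑ ^ 2 := by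
        rw [lintegral_lintegral_swap]
        exact Measurable.aemeasurable (by fun_prop)
    _ = M * ∫⁻ w, ‖g w‖ₑ ^ 2 * ∫⁻ z, ‖g z‖ₑ ^ 2 := by
        congr 2 with w
        rw [lintegral_const_mul _ (by fun_prop), lintegral_sub_right_eq_self (fun z => ‖g z‖ₑ ^ 2)]
    _ = _ := by
        rw [lintegral_mul_const _ (by fun_prop), sq]


open FourierTransform in
theorem piece_L3 {V : Type*} [NormedAddCommGroup V] [InnerProductSpace ℝ V]
    [FiniteDimensional ℝ V] [MeasurableSpace V] [BorelSpace V] {g : V → ℂ} (hm : Measurable g)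
    (h1 : Integrable g) (h2 : MemLp g 2)
    (S : Set V) (hS : MeasurableSet S) (hgS : ∀ x ∉ S, g x = 0)
    (M : ℝ≥0∞) (hMt : M ≠ ⊤) (hM : ∀ z, volume {w : V | w ∈ S ∧ z - w ∈ S} ≤ M) :
    eLpNorm (𝓕 g) 3 ≤ M ^ (1 / 6 : ℝ) * (∫⁻ w, ‖g w‖ₑ ^ 2) ^ (1 / 2 : ℝ) := by
  set A := ∫⁻ w, ‖g w‖ₑ ^ 2 with hA
  have hAt : A ≠ ⊤ := by
    rw [hA, ← eL2]; exact ENNReal.pow_ne_top h2.2.ne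
  have hcont := cont_fourier h1
  set h := convolution g g (ContinuousLinearMap.mul ℂ ℂ) volume with hh
  have hb := conv_bound hm S hS hgS M hM
  have hi : Integrable h := h1.integrable_convolution _ h1
  have hL2 : MemLp h 2 := by
    refine ⟨hi.1, ?_⟩
    have : eLpNorm h 2 ^ 2 < ⊤ := by
      rw [eL2]
      exact hb.trans_lt (ENNReal.mul_lt_top hMt.lt_top (ENNReal.pow_lt_top hAt.lt_top))
    exact (ENNReal.pow_lt_top_iff.1 this).resolve_right (by norm_num)
  have four : ∫⁻ x, (‖𝓕 g x‖ₑ ^ 2) ^ 2 ≤ M * A ^ 2 := by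
    have := plancherel_aux hi hL2
    have e : ∀ x, 𝓕 h x = 𝓕 g x * 𝓕 g x := Real.fourier_mul_convolution_eq h1 h1
    calc ∫⁻ x, (‖𝓕 g x‖ₑ ^ 2) ^ 2 = ∫⁻ x, ‖𝓕 h x‖ₑ ^ 2 := by
          simp_rw [e, enorm_mul, sq]
      _ = ∫⁻ x, ‖h x‖ₑ ^ 2 := by rw [← eL2, ← eL2, this]
      _ ≤ _ := hb
  have two : ∫⁻ x, ‖𝓕 g x‖ₑ ^ 2 = A := by
    rw [hA, ← eL2, ← eL2, plancherel_aux h1 h2]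
  have three : (∫⁻ x, ‖𝓕 g x‖ₑ ^ 3) ^ 2 ≤ M * A ^ 3 := by
    calc (∫⁻ x, ‖𝓕 g x‖ₑ ^ 3) ^ 2 = (∫⁻ x, ‖𝓕 g x‖ₑ * ‖𝓕 g x‖ₑ ^ 2) ^ 2 := by
          congr 2 with x; ring
      _ ≤ (∫⁻ x, ‖𝓕 g x‖ₑ ^ 2) * ∫⁻ x, (‖𝓕 g x‖ₑ ^ 2) ^ 2 := by
          apply cs_lint
          · exact hcont.measurable.enorm.aemeasurable
          · exact (hcont.measurable.enorm.pow_const 2).aemeasurable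
      _ ≤ A * (M * A ^ 2) := by rw [two]; gcongr
      _ = _ := by ring
  rw [eLpNorm_eq_lintegral_rpow_enorm_toReal (by norm_num) (by norm_num)]
  have e3 : (3 : ℝ≥0∞).toReal = ((3 : ℕ) : ℝ) := by simp
  simp_rw [e3, ENNReal.rpow_natCast]
  calc (∫⁻ x, ‖𝓕 g x‖ₑ ^ 3) ^ (1 / ((3 : ℕ) : ℝ))
      = ((∫⁻ x, ‖𝓕 g x‖ₑ ^ 3) ^ 2) ^ (1 / 6 : ℝ) := by
        rw [← ENNReal.rpow_natCast, ← ENNReal.rpow_mul]; norm_num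
    _ ≤ (M * A ^ 3) ^ (1 / 6 : ℝ) := by gcongr
    _ = _ := by
        rw [ENNReal.mul_rpow_of_nonneg _ _ (by norm_num), ← ENNReal.rpow_natCast,
          ← ENNReal.rpow_mul]; norm_num

/-- The Euclidean plane. -/
abbrev Pl : Type := WithLp 2 (ℝ × ℝ)

theorem cont_fst : Continuous (fun q : Pl => q.fst) := by
  exact continuous_fst.comp (WithLp.prod_continuous_ofLp 2 ℝ ℝ)

theorem cont_snd : Continuous (fun q : Pl => q.snd) := by
  exact continuous_snd.comp (WithLp.prod_continuous_ofLp 2 ℝ ℝ)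

theorem cont_jb (c : ℝ) : Continuous (fun q : Pl => jb (q.fst + c * q.snd ^ 2)) := by
  unfold jb
  have := cont_fst
  have := cont_snd
  fun_prop

theorem vol3 (c K : ℝ) (hc : c ≠ 0) (hK : 0 ≤ K) (z : Pl) :
    volume {w : Pl | w ∈ {q : Pl | |q.fst + c * q.snd ^ 2| ≤ K} ∧
      z - w ∈ {q : Pl | |q.fst + c * q.snd ^ 2| ≤ K}} ≤
      ENNReal.ofReal (2 * Real.sqrt (2 * K / |c|)) * ENNReal.ofReal (2 * K) := by
  refine le_trans (le_of_eq ?_) (vol2 c K hc hK z.ofLp)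
  rw [← (WithLp.volume_preserving_ofLp ℝ ℝ).measure_preimage]
  · rfl
  · apply MeasurableSet.nullMeasurableSet
    have c1 : IsClosed {w : ℝ × ℝ | |w.1 + c * w.2 ^ 2| ≤ K} :=
      isClosed_le (by fun_prop) (by fun_prop)
    have c2 : IsClosed {w : ℝ × ℝ | |(z.ofLp.1 - w.1) + c * (z.ofLp.2 - w.2) ^ 2| ≤ K} :=
      isClosed_le (by fun_prop) (by fun_prop)
    exact (c1.inter c2).measurableSet

theorem const_aux (c b : ℝ) (hc : c ≠ 0) (j : ℕ) :
    (ENNReal.ofReal (2 * Real.sqrt (2 * 2 ^ (j + 1) / |c|)) *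
      ENNReal.ofReal (2 * 2 ^ (j + 1))) ^ (1 / 6 : ℝ) *
      (ENNReal.ofReal (((2 : ℝ) ^ j) ^ (-(2 * b)))) ^ (1 / 2 : ℝ) =
    ENNReal.ofReal (((4 * Real.sqrt (2 / |c|)) ^ (1 / 6 : ℝ) * 2 ^ (1 / 4 : ℝ)) *
      ((2 : ℝ) ^ (1 / 4 - b)) ^ j) := by
  have hc' : 0 < |c| := abs_pos.mpr hc
  rw [← ENNReal.ofReal_mul (by positivity), ENNReal.ofReal_rpow_of_nonneg (by positivity) (by norm_num),
    ENNReal.ofReal_rpow_of_nonneg (by positivity) (by norm_num),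
    ← ENNReal.ofReal_mul (by positivity)]
  congr 1
  have e1 : 2 * Real.sqrt (2 * 2 ^ (j + 1) / |c|) * (2 * 2 ^ (j + 1)) =
      (4 * Real.sqrt (2 / |c|)) * ((2 : ℝ) ^ (j + 1)) ^ (3 / 2 : ℝ) := by
    have : (2 * 2 ^ (j + 1) / |c| : ℝ) = (2 / |c|) * 2 ^ (j + 1) := by ring
    rw [this, Real.sqrt_mul (by positivity), Real.sqrt_eq_rpow (2 ^ (j + 1))]
    have : ((2 : ℝ) ^ (j + 1)) ^ (3 / 2 : ℝ) = ((2 : ℝ) ^ (j + 1)) ^ (1 / 2 : ℝ) * 2 ^ (j + 1) := by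
      rw [← Real.rpow_add_one (by positivity)]; norm_num
    rw [this]; ring
  rw [e1, Real.mul_rpow (by positivity) (by positivity), mul_assoc, mul_assoc]
  congr 1
  simp only [← Real.rpow_natCast, ← Real.rpow_mul (zero_le_two : (0 : ℝ) ≤ 2)]
  rw [← Real.rpow_add two_pos, ← Real.rpow_add two_pos]
  congr 1
  push_cast
  ring

open FourierTransform in
theorem main_plane (c b : ℝ) (hc : c ≠ 0) (hb : 1 / 4 < b) : ∃ C : ℝ, 0 < C ∧
    ∀ g : Pl → ℂ, Measurable g → Integrable g → MemLp g 2 →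
      eLpNorm (𝓕 g) 3 ≤ ENNReal.ofReal C *
        (∫⁻ q : Pl, ENNReal.ofReal (jb (q.fst + c * q.snd ^ 2) ^ (2 * b)) * ‖g q‖ₑ ^ 2)
          ^ (1 / 2 : ℝ) := by
  have hc' : 0 < |c| := abs_pos.mpr hc
  set C1 : ℝ := (4 * Real.sqrt (2 / |c|)) ^ (1 / 6 : ℝ) * 2 ^ (1 / 4 : ℝ) with hC1
  have hC1p : 0 < C1 := by positivity
  set r : ℝ := (2 : ℝ) ^ (1 / 4 - b) with hr
  have hr0 : 0 < r := by positivity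
  have hr1 : r < 1 := Real.rpow_lt_one_of_one_lt_of_neg one_lt_two (by linarith)
  refine ⟨C1 * (1 - r)⁻¹, mul_pos hC1p (inv_pos.2 (by linarith)), ?_⟩
  intro g hm h1 h2
  set J : Pl → ℝ := fun q => jb (q.fst + c * q.snd ^ 2) with hJ
  have hJc : Continuous J := cont_jb c
  have hJ1 : ∀ q, 1 ≤ J q := fun q => by simp [hJ, jb]
  set W := ∫⁻ q : Pl, ENNReal.ofReal (J q ^ (2 * b)) * ‖g q‖ₑ ^ 2 with hW
  have hD : ∀ j : ℕ, MeasurableSet {q | (2 : ℝ) ^ j ≤ J q ∧ J q < 2 ^ (j + 1)} := fun j =>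
    (measurableSet_le measurable_const hJc.measurable).inter
      (measurableSet_lt hJc.measurable measurable_const)
  have hE : ∀ j : ℕ, MeasurableSet {q | J q < (2 : ℝ) ^ j} := fun j =>
    measurableSet_lt hJc.measurable measurable_const
  set gD : ℕ → Pl → ℂ := fun j => {q | (2 : ℝ) ^ j ≤ J q ∧ J q < 2 ^ (j + 1)}.indicator g with hgD
  set gE : ℕ → Pl → ℂ := fun j => {q | J q < (2 : ℝ) ^ j}.indicator g with hgE
  have iD : ∀ j, Integrable (gD j) := fun j => h1.indicator (hD j)
  have iE : ∀ j, Integrable (gE j) := fun j => h1.indicator (hE j)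
  have piece : ∀ j, eLpNorm (𝓕 (gD j)) 3 ≤ ENNReal.ofReal (C1 * r ^ j) * W ^ (1 / 2 : ℝ) := by
    intro j
    have hS : MeasurableSet {q : Pl | |q.fst + c * q.snd ^ 2| ≤ (2 : ℝ) ^ (j + 1)} := by
      have e : {q : Pl | |q.fst + c * q.snd ^ 2| ≤ (2 : ℝ) ^ (j + 1)} =
          {q : Pl | J q ≤ 1 + (2 : ℝ) ^ (j + 1)} := by
        ext q; simp [hJ, jb]
      rw [e]
      exact measurableSet_le hJc.measurable measurable_const
    have p1 := piece_L3 (g := gD j) (hm.indicator (hD j)) (iD j) (h2.indicator (hD j))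
      {q : Pl | |q.fst + c * q.snd ^ 2| ≤ (2 : ℝ) ^ (j + 1)} hS (by
        intro x hx
        apply Set.indicator_of_notMem
        intro h
        apply hx
        have := h.2
        simp only [hJ, jb] at this
        change |x.fst + c * x.snd ^ 2| ≤ _
        linarith) _ (ENNReal.mul_ne_top ENNReal.ofReal_ne_top ENNReal.ofReal_ne_top)
      (vol3 c (2 ^ (j + 1)) hc (by positivity))
    have p2 : ∫⁻ w, ‖gD j w‖ₑ ^ 2 ≤ ENNReal.ofReal (((2 : ℝ) ^ j) ^ (-(2 * b))) * W := by
      rw [hW, ← lintegral_const_mul' _ _ ENNReal.ofReal_ne_top]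
      apply lintegral_mono
      intro q
      by_cases hq : q ∈ {q | (2 : ℝ) ^ j ≤ J q ∧ J q < 2 ^ (j + 1)}
      · simp only [hgD, Set.indicator_of_mem hq]
        rw [← mul_assoc, ← ENNReal.ofReal_mul (by positivity)]
        apply le_mul_of_one_le_left (zero_le)
        rw [ENNReal.one_le_ofReal, Real.rpow_neg (by positivity), inv_mul_eq_div,
          one_le_div (by positivity)]
        exact Real.rpow_le_rpow (by positivity) hq.1 (by linarith)
      · simp [hgD, Set.indicator_of_notMem hq]
    rw [hC1, hr, ← const_aux c b hc j, mul_assoc]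
    refine p1.trans ?_
    gcongr
    rw [← ENNReal.mul_rpow_of_nonneg _ _ (by norm_num)]
    gcongr
  have part : ∀ n, eLpNorm (𝓕 (gE n)) 3 ≤
      (∑ j ∈ Finset.range n, ENNReal.ofReal (C1 * r ^ j)) * W ^ (1 / 2 : ℝ) := by
    intro n
    induction n with
    | zero =>
      have : gE 0 = 0 := by
        ext q
        simp only [hgE, pow_zero]
        rw [Set.indicator_of_notMem]
        · rfl
        · exact fun h => absurd (hJ1 q) (not_le.2 h)
      have h0 : 𝓕 (gE 0) = 0 := by
        rw [this]; ext x; simp [Real.fourier_eq]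
      rw [h0]; simp
    | succ n ih =>
      have e : gE (n + 1) = gE n + gD n := by
        ext q
        simp only [hgE, hgD, Pi.add_apply, Set.indicator_apply]
        have : (2 : ℝ) ^ n ≤ 2 ^ (n + 1) := pow_le_pow_right₀ one_le_two (by omega)
        by_cases h : J q < 2 ^ n
        · have h' : J q < 2 ^ (n + 1) := h.trans_le this
          simp [h, h', not_le.2 h]
        · by_cases h' : J q < 2 ^ (n + 1) <;> simp [h, h', not_lt.1 h]
      have e2 : 𝓕 (gE (n + 1)) = 𝓕 (gE n) + 𝓕 (gD n) := by
        rw [e]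
        ext x
        exact congrFun (VectorFourier.fourierIntegral_add Real.continuous_fourierChar
          (by exact continuous_inner) (iE n) (iD n)) x
      rw [e2, Finset.sum_range_succ, add_mul]
      refine (eLpNorm_add_le (cont_fourier (iE n)).aestronglyMeasurable
        (cont_fourier (iD n)).aestronglyMeasurable (by norm_num)).trans ?_
      exact add_le_add ih (piece n)
  have part2 : ∀ n, eLpNorm (𝓕 (gE n)) 3 ≤
      ENNReal.ofReal (C1 * (1 - r)⁻¹) * W ^ (1 / 2 : ℝ) := by
    intro n
    refine (part n).trans ?_
    gcongr
    rw [← ENNReal.ofReal_sum_of_nonneg (fun j _ => by positivity)]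
    apply ENNReal.ofReal_le_ofReal
    rw [← Finset.mul_sum, ← tsum_geometric_of_lt_one hr0.le hr1]
    gcongr
    exact (summable_geometric_of_lt_one hr0.le hr1).sum_le_tsum _ (fun j _ => by positivity)
  refine (Lp.eLpNorm_lim_le_liminf_eLpNorm (f := fun n => 𝓕 (gE n))
    (fun n => (cont_fourier (iE n)).aestronglyMeasurable) (𝓕 g) ?_).trans ?_
  · refine Filter.Eventually.of_forall fun x => ?_
    simp only [Real.fourier_eq]
    apply tendsto_integral_of_dominated_convergence (fun q => ‖g q‖)
    · intro n
      exact ((Real.fourierIntegral_convergent_iff x).2 (iE n)).1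
    · exact h1.norm
    · intro n
      refine Filter.Eventually.of_forall fun q => ?_
      rw [Circle.norm_smul]
      exact norm_indicator_le_norm_self _ _
    · refine Filter.Eventually.of_forall fun q => ?_
      apply tendsto_const_nhds.congr'
      obtain ⟨N, hN⟩ := pow_unbounded_of_one_lt (J q) (one_lt_two)
      filter_upwards [Filter.eventually_ge_atTop N] with n hn
      have : q ∈ {q | J q < (2 : ℝ) ^ n} := hN.trans_le (pow_le_pow_right₀ one_le_two hn)
      simp only [hgE, Set.indicator_of_mem this]
  · refine Filter.liminf_le_of_frequently_le' ?_
    exact Filter.Frequently.of_forall part2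

open FourierTransform in
theorem ft_eq (u : SchwartzMap (ℝ × ℝ) ℂ) (v : SchwartzMap Pl ℂ) (hv : ∀ q : Pl, v q = u q.ofLp)
    (τ ξ : ℝ) : ft (fun p => u p) τ ξ =
      (2 * Real.pi : ℂ)⁻¹ * (𝓕 v) (WithLp.toLp 2 ((2 * Real.pi)⁻¹ * τ, (2 * Real.pi)⁻¹ * ξ)) := by
  unfold ft
  congr 1
  rw [SchwartzMap.fourier_coe, Real.fourier_eq,
    ← (WithLp.volume_preserving_ofLp ℝ ℝ).integral_comp
      (MeasurableEquiv.toLp 2 (ℝ × ℝ)).symm.measurableEmbedding]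
  congr 1 with q
  rw [hv, Circle.smul_def, Real.fourierChar_apply, smul_eq_mul, mul_comm]
  congr 2
  rw [WithLp.prod_inner_apply]
  simp only [RCLike.inner_apply, conj_trivial]
  push_cast
  have : (Real.pi : ℂ) ≠ 0 := by exact_mod_cast Real.pi_ne_zero
  field_simp
  ring

theorem abs_fst_le (q : Pl) : |q.fst| ≤ ‖q‖ := by
  have := WithLp.prod_norm_sq_eq_of_L2 q
  rw [Real.norm_eq_abs, Real.norm_eq_abs] at this
  apply abs_le_of_sq_le_sq _ (norm_nonneg _)
  nlinarith [sq_nonneg |q.snd|, sq_abs q.fst]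

theorem abs_snd_le (q : Pl) : |q.snd| ≤ ‖q‖ := by
  have := WithLp.prod_norm_sq_eq_of_L2 q
  rw [Real.norm_eq_abs, Real.norm_eq_abs] at this
  apply abs_le_of_sq_le_sq _ (norm_nonneg _)
  nlinarith [sq_nonneg |q.fst|, sq_abs q.snd]

theorem integrable_weight (f : SchwartzMap Pl ℂ) (φ : ℝ → ℝ) (hφ : Continuous φ) (c0 b : ℝ)
    (hb : 0 ≤ b) (h0 : 0 ≤ c0) (hc0 : ∀ y, |φ y| ≤ c0 * y ^ 2) :
    Integrable (fun q : Pl => jb (2 * Real.pi * q.fst + φ (2 * Real.pi * q.snd)) ^ (2 * b)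
      * ‖f q‖ ^ 2) := by
  obtain ⟨N, hN⟩ := exists_nat_ge (2 * (2 * b))
  obtain ⟨B, hB⟩ := f.decay 0 0
  have hB' : ∀ q, ‖f q‖ ≤ B := fun q => by simpa using hB.2 q
  set D : ℝ := 1 + 2 * Real.pi + c0 * (2 * Real.pi) ^ 2 with hD
  have hDp : 0 < D := by positivity
  have i1 : Integrable (fun q : Pl => (D ^ (2 * b) * 2 ^ N * B) * (‖f q‖ + ‖q‖ ^ N * ‖f q‖)) :=
    (f.integrable.norm.add (f.integrable_pow_mul volume N)).const_mul _
  have m1 := cont_fst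
  have m2 := cont_snd
  have hjc : Continuous (fun q : Pl => jb (2 * Real.pi * q.fst + φ (2 * Real.pi * q.snd))) := by
    unfold jb; fun_prop
  refine i1.mono' ?_ (Filter.Eventually.of_forall fun q => ?_)
  · apply Continuous.aestronglyMeasurable
    refine (hjc.rpow_const fun q => Or.inr (by linarith)).mul (f.continuous.norm.pow 2)
  · have hj : jb (2 * Real.pi * q.fst + φ (2 * Real.pi * q.snd)) ≤ D * (1 + ‖q‖) ^ 2 := by
      have a1 := abs_add_le (2 * Real.pi * q.fst) (φ (2 * Real.pi * q.snd))
      have a2 := hc0 (2 * Real.pi * q.snd)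
      have a3 := abs_fst_le q
      have a4 := abs_snd_le q
      have a5 : q.snd ^ 2 ≤ ‖q‖ ^ 2 := by rw [← sq_abs]; gcongr
      rw [abs_mul, abs_of_pos (by positivity : 0 < 2 * Real.pi)] at a1
      have n0 := norm_nonneg q
      have a6 : c0 * (2 * Real.pi * q.snd) ^ 2 ≤ c0 * (2 * Real.pi) ^ 2 * (1 + ‖q‖) ^ 2 := by
        rw [mul_pow, ← mul_assoc]
        exact mul_le_mul_of_nonneg_left (by nlinarith) (by positivity)
      have a7 : 2 * Real.pi * |q.fst| ≤ 2 * Real.pi * (1 + ‖q‖) ^ 2 := by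
        gcongr; nlinarith
      have a8 : 1 ≤ (1 + ‖q‖) ^ 2 := by nlinarith
      unfold jb
      rw [hD]; linarith
    have hj0 : 0 ≤ jb (2 * Real.pi * q.fst + φ (2 * Real.pi * q.snd)) := by unfold jb; positivity
    have h1 : jb (2 * Real.pi * q.fst + φ (2 * Real.pi * q.snd)) ^ (2 * b) ≤
        D ^ (2 * b) * (2 ^ N * (1 + ‖q‖ ^ N)) := by
      calc _ ≤ (D * (1 + ‖q‖) ^ 2) ^ (2 * b) := Real.rpow_le_rpow hj0 hj (by linarith)
        _ = D ^ (2 * b) * (1 + ‖q‖) ^ (2 * (2 * b)) := by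
            rw [Real.mul_rpow hDp.le (by positivity), ← Real.rpow_natCast, ← Real.rpow_mul (by positivity)]
            norm_num
        _ ≤ D ^ (2 * b) * (1 + ‖q‖) ^ (N : ℝ) := by
            gcongr
            linarith [norm_nonneg q]
        _ ≤ _ := by
            rw [Real.rpow_natCast]
            gcongr
            have n0 := norm_nonneg q
            rcases le_total ‖q‖ 1 with h | h
            · have : (1 + ‖q‖) ^ N ≤ 2 ^ N := by gcongr; linarith
              have : (0 : ℝ) ≤ 2 ^ N * ‖q‖ ^ N := by positivity
              linarith
            · have : (1 + ‖q‖) ^ N ≤ (2 * ‖q‖) ^ N := by gcongr; linarith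
              rw [mul_pow] at this
              have : (0 : ℝ) ≤ 2 ^ N := by positivity
              linarith
    rw [Real.norm_of_nonneg (by positivity)]
    calc _ ≤ (D ^ (2 * b) * (2 ^ N * (1 + ‖q‖ ^ N))) * (B * ‖f q‖) := by
          rw [sq]; gcongr; exact hB' q
      _ = _ := by ring

open FourierTransform in
theorem weight_le (u : SchwartzMap (ℝ × ℝ) ℂ) (v : SchwartzMap Pl ℂ)
    (hv : ∀ q : Pl, v q = u q.ofLp) (φ : ℝ → ℝ) (hφ : Continuous φ) (c0 b : ℝ)
    (hb : 0 ≤ b) (h0 : 0 ≤ c0) (hc0 : ∀ y, |φ y| ≤ c0 * y ^ 2)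
    (hhom : ∀ y, φ (2 * Real.pi * y) = (2 * Real.pi) ^ 2 * φ y) :
    ∫⁻ q : Pl, ENNReal.ofReal (jb (q.fst + 2 * Real.pi * φ q.snd) ^ (2 * b)) * ‖(𝓕 v) q‖ₑ ^ 2 ≤
      ENNReal.ofReal (∫ q : ℝ × ℝ, jb (q.1 + φ q.2) ^ (2 * b) *
        ‖ft (fun p => u p) q.1 q.2‖ ^ 2) := by
  set f := 𝓕 v with hf
  have hpi := Real.pi_pos
  have hint := integrable_weight f φ hφ c0 b hb h0 hc0
  have e1 : ∫ q : ℝ × ℝ, jb (q.1 + φ q.2) ^ (2 * b) * ‖ft (fun p => u p) q.1 q.2‖ ^ 2 =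
      ∫ q : Pl, jb (2 * Real.pi * q.fst + φ (2 * Real.pi * q.snd)) ^ (2 * b) * ‖f q‖ ^ 2 := by
    have s := Measure.integral_comp_smul (volume : Measure (ℝ × ℝ))
      (fun p : ℝ × ℝ => jb (2 * Real.pi * p.1 + φ (2 * Real.pi * p.2)) ^ (2 * b) *
        (((2 * Real.pi)⁻¹) ^ 2 * ‖f (WithLp.toLp 2 p)‖ ^ 2)) (2 * Real.pi)⁻¹
    have lhs : ∀ q : ℝ × ℝ, jb (q.1 + φ q.2) ^ (2 * b) * ‖ft (fun p => u p) q.1 q.2‖ ^ 2 =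
        (fun p : ℝ × ℝ => jb (2 * Real.pi * p.1 + φ (2 * Real.pi * p.2)) ^ (2 * b) *
        (((2 * Real.pi)⁻¹) ^ 2 * ‖f (WithLp.toLp 2 p)‖ ^ 2)) ((2 * Real.pi)⁻¹ • q) := by
      intro q
      simp only [Prod.smul_fst, Prod.smul_snd, smul_eq_mul]
      rw [mul_inv_cancel_left₀ (by positivity), mul_inv_cancel_left₀ (by positivity),
        ft_eq u v hv, norm_mul, mul_pow]
      congr 3
      rw [norm_inv, norm_mul, Complex.norm_real, Real.norm_of_nonneg hpi.le]; norm_num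
    simp_rw [lhs]
    rw [s, ← (WithLp.volume_preserving_ofLp ℝ ℝ).integral_comp
      (MeasurableEquiv.toLp 2 (ℝ × ℝ)).symm.measurableEmbedding, smul_eq_mul, ← integral_const_mul]
    congr 1 with q
    have : |(((2 * Real.pi)⁻¹) ^ Module.finrank ℝ (ℝ × ℝ))⁻¹| = (2 * Real.pi) ^ 2 := by
      rw [Module.finrank_prod, Module.finrank_self, abs_of_nonneg (by positivity), inv_pow, inv_inv]
    rw [this]
    change _ * (jb (2 * Real.pi * q.fst + φ (2 * Real.pi * q.snd)) ^ (2 * b) *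
      ((2 * Real.pi)⁻¹ ^ 2 * ‖f q‖ ^ 2)) = _
    field_simp
  rw [e1, ofReal_integral_eq_lintegral_ofReal hint]
  · apply lintegral_mono
    intro q
    beta_reduce
    have p0 : ∀ x, 0 < jb x := fun x => by unfold jb; positivity
    rw [ENNReal.ofReal_mul (by have := p0 (2 * Real.pi * q.fst + φ (2 * Real.pi * q.snd)); positivity),
      ENNReal.ofReal_pow (norm_nonneg _), ofReal_norm]
    gcongr ENNReal.ofReal (?_ ^ _) * _
    · exact (p0 _).le
    · rw [hhom]
      have : 2 * Real.pi * q.fst + (2 * Real.pi) ^ 2 * φ q.snd =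
        (2 * Real.pi) * (q.fst + 2 * Real.pi * φ q.snd) := by ring
      rw [this]
      unfold jb
      rw [abs_mul, abs_of_pos (by positivity : 0 < 2 * Real.pi)]
      have := abs_nonneg (q.fst + 2 * Real.pi * φ q.snd)
      nlinarith [Real.pi_gt_three]
  · exact Filter.Eventually.of_forall fun q => by
      have : 0 < jb (2 * Real.pi * q.fst + φ (2 * Real.pi * q.snd)) := by unfold jb; positivity
      simp only [Pi.zero_apply]
      positivity

open FourierTransform in
theorem norm_eq (u : SchwartzMap (ℝ × ℝ) ℂ) (v : SchwartzMap Pl ℂ)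
    (hv : ∀ q : Pl, v q = u q.ofLp) :
    eLpNorm (fun p => u p) 3 volume = eLpNorm (𝓕 ((𝓕 v : SchwartzMap Pl ℂ) : Pl → ℂ)) 3 := by
  have e1 : eLpNorm (fun p => u p) 3 volume = eLpNorm (v : Pl → ℂ) 3 := by
    rw [← eLpNorm_comp_measurePreserving u.continuous.aestronglyMeasurable
      (WithLp.volume_preserving_ofLp ℝ ℝ)]
    congr 1
    ext q
    exact (hv q).symm
  have e2 : (v : Pl → ℂ) = (𝓕 ((𝓕 v : SchwartzMap Pl ℂ) : Pl → ℂ)) ∘ Neg.neg := by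
    have : v = 𝓕⁻ (𝓕 v) := by simp
    ext q
    conv_lhs => rw [this]
    rw [SchwartzMap.fourierInv_coe, Real.fourierInv_eq_fourier_neg]
    rfl
  rw [e1]
  conv_lhs => rw [e2]
  rw [eLpNorm_comp_measurePreserving _ (Measure.measurePreserving_neg volume)]
  exact (cont_fourier (𝓕 v).integrable).aestronglyMeasurable

theorem finish {C Q : ℝ} (hC : 0 < C) (hQ : 0 ≤ Q) {W : ℝ≥0∞} (h : W ≤ ENNReal.ofReal Q) :
    ENNReal.ofReal C * W ^ (1 / 2 : ℝ) ≤ ENNReal.ofReal (C * Q ^ (1 / 2 : ℝ)) := by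
  rw [ENNReal.ofReal_mul hC.le, ← ENNReal.ofReal_rpow_of_nonneg hQ (by norm_num)]
  gcongr


/-- Bourgain–Strichartz estimates: `‖u‖_{L³} ≲ ‖u‖_{X^{0,b}}` and
`‖u‖_{L³} ≲ ‖u‖_{Y_γ^{0,b}}` for `b > 1/4`. -/
theorem bourgain_strichartz_L3 (γ b : ℝ) (hγ : γ ≠ 0) (hγ1 : |γ| ≠ 1) (hb : 1/4 < b) :
    ∃ C : ℝ, 0 < C ∧ ∀ u : SchwartzMap (ℝ × ℝ) ℂ,
      (eLpNorm (fun p => u p) 3 volume ≤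
        ENNReal.ofReal (C *
          (∫ q : ℝ × ℝ, jb (q.1 + q.2 ^ 2) ^ (2 * b) * ‖ft (fun p => u p) q.1 q.2‖ ^ 2)
            ^ (1/2 : ℝ))) ∧
      (eLpNorm (fun p => u p) 3 volume ≤
        ENNReal.ofReal (C *
          (∫ q : ℝ × ℝ,
              jb (q.1 + γ * |q.2| * q.2) ^ (2 * b) * ‖ft (fun p => u p) q.1 q.2‖ ^ 2)
            ^ (1/2 : ℝ))) := by
  have hpi := Real.pi_pos
  obtain ⟨C1, hC1, H1⟩ := main_plane (2 * Real.pi) b (by positivity) hb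
  obtain ⟨C2, hC2, H2⟩ := main_plane (2 * Real.pi * γ) b (mul_ne_zero (by positivity) hγ) hb
  obtain ⟨C3, hC3, H3⟩ := main_plane (2 * Real.pi * (-γ)) b
    (mul_ne_zero (by positivity) (neg_ne_zero.2 hγ)) hb
  refine ⟨C1 + (C2 + C3), by positivity, fun u => ?_⟩
  let v : SchwartzMap Pl ℂ := SchwartzMap.compCLMOfContinuousLinearEquiv ℂ
    (WithLp.prodContinuousLinearEquiv 2 ℝ ℝ ℝ) u
  have hv : ∀ q : Pl, v q = u q.ofLp := fun q => rfl
  set f : SchwartzMap Pl ℂ := FourierTransform.fourier v with hf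
  have hu := norm_eq u v hv
  rw [← hf] at hu
  have p0 : ∀ x, 0 ≤ jb x := fun x => by unfold jb; positivity
  have mf : Measurable (f : Pl → ℂ) := f.continuous.measurable
  have if1 : Integrable (f : Pl → ℂ) := f.integrable
  have if2 : MemLp (f : Pl → ℂ) 2 := f.memLp 2 volume
  constructor
  · set Q := ∫ q : ℝ × ℝ, jb (q.1 + q.2 ^ 2) ^ (2 * b) * ‖ft (fun p => u p) q.1 q.2‖ ^ 2 with hQ
    have hQ0 : 0 ≤ Q := integral_nonneg fun q =>
      mul_nonneg (Real.rpow_nonneg (p0 _) _) (sq_nonneg _)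
    have w := weight_le u v hv (fun y => y ^ 2) (by fun_prop) 1 b (by linarith) zero_le_one
      (fun y => by rw [one_mul, abs_of_nonneg (sq_nonneg y)]) (fun y => by ring)
    rw [hu]
    refine ((H1 f mf if1 if2).trans (finish hC1 hQ0 w)).trans ?_
    apply ENNReal.ofReal_le_ofReal
    gcongr
    linarith
  · set Q := ∫ q : ℝ × ℝ,
      jb (q.1 + γ * |q.2| * q.2) ^ (2 * b) * ‖ft (fun p => u p) q.1 q.2‖ ^ 2 with hQ
    have hQ0 : 0 ≤ Q := integral_nonneg fun q =>
      mul_nonneg (Real.rpow_nonneg (p0 _) _) (sq_nonneg _)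
    have w := weight_le u v hv (fun y => γ * |y| * y) (by fun_prop) |γ| b (by linarith)
      (abs_nonneg γ)
      (fun y => by rw [abs_mul, abs_mul, abs_abs, mul_assoc, ← sq, sq_abs])
      (fun y => by rw [abs_mul, abs_of_pos (by positivity : 0 < 2 * Real.pi)]; ring)
    have hP : MeasurableSet {q : Pl | 0 ≤ q.snd} :=
      measurableSet_le measurable_const cont_snd.measurable
    set f1 : Pl → ℂ := {q : Pl | 0 ≤ q.snd}.indicator f with hf1
    set f2 : Pl → ℂ := {q : Pl | 0 ≤ q.snd}ᶜ.indicator f with hf2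
    have i1 : Integrable f1 := if1.indicator hP
    have i2 : Integrable f2 := if1.indicator hP.compl
    have w1 : ∫⁻ q : Pl, ENNReal.ofReal (jb (q.fst + 2 * Real.pi * γ * q.snd ^ 2) ^ (2 * b)) *
        ‖f1 q‖ₑ ^ 2 ≤ ENNReal.ofReal Q := by
      refine le_trans (lintegral_mono fun q => ?_) w
      by_cases hq : q ∈ {q : Pl | 0 ≤ q.snd}
      · simp only [hf1, Set.indicator_of_mem hq]
        rw [abs_of_nonneg (show 0 ≤ q.snd from hq)]
        apply le_of_eq
        congr 4
        ring
      · simp [hf1, Set.indicator_of_notMem hq]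
    have w2 : ∫⁻ q : Pl, ENNReal.ofReal (jb (q.fst + 2 * Real.pi * (-γ) * q.snd ^ 2) ^ (2 * b)) *
        ‖f2 q‖ₑ ^ 2 ≤ ENNReal.ofReal Q := by
      refine le_trans (lintegral_mono fun q => ?_) w
      by_cases hq : q ∈ {q : Pl | 0 ≤ q.snd}ᶜ
      · simp only [hf2, Set.indicator_of_mem hq]
        rw [abs_of_neg (show q.snd < 0 from not_le.1 hq)]
        apply le_of_eq
        congr 4
        ring
      · simp only [hf2, Set.indicator_of_notMem hq]
        simp
    have hsum : FourierTransform.fourier (f : Pl → ℂ) =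
        FourierTransform.fourier f1 + FourierTransform.fourier f2 := by
      have e : (f : Pl → ℂ) = f1 + f2 := (Set.indicator_self_add_compl _ _).symm
      rw [e]
      ext x
      exact congrFun (VectorFourier.fourierIntegral_add Real.continuous_fourierChar
        (by exact continuous_inner) i1 i2) x
    rw [hu, hsum]
    refine (eLpNorm_add_le (cont_fourier i1).aestronglyMeasurable
      (cont_fourier i2).aestronglyMeasurable (by norm_num)).trans ?_
    refine (add_le_add
      ((H2 f1 (mf.indicator hP) i1 (if2.indicator hP)).trans (finish hC2 hQ0 w1))
      ((H3 f2 (mf.indicator hP.compl) i2 (if2.indicator hP.compl)).trans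
        (finish hC3 hQ0 w2))).trans ?_
    rw [← ENNReal.ofReal_add (by positivity) (by positivity), ← add_mul]
    apply ENNReal.ofReal_le_ofReal
    exact mul_le_mul_of_nonneg_right (by linarith) (by positivity)
end
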